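/- arXiv:2007.05472 — 9 statements merged into one kernel-verified Lean document; each statement's English description precedes it below -/
import Mathlib

section
/- Let I = (n_1, …, n_l) be a composition of n and suppose that for each 1 ≤ i ≤ l the subgroup G_i ≤ GL_{n_i}(F_q) is generated by its pseudo-reflections. Then the block upper triangular group G_I ≤ GL_n(F_q) (whose i-th diagonal block ranges over G_i, with arbitrary entries above the diagonal blocks) is generated by its pseudo-reflections. -/
open MvPolynomial Finset

/-- The action of a matrix `g` on `F_q[x_1, …, x_n]`: the algebra map sending
`x_j` to `Σ_i g_{ij} x_i`. -/
noncomputable def matAct {K : Type*} [Field K] {n : ℕ} (g : Matrix (Fin n) (Fin n) K) :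
    MvPolynomial (Fin n) K →ₐ[K] MvPolynomial (Fin n) K :=
  aeval fun j => ∑ i, C (g i j) * X i

/-- The subalgebra of polynomials invariant under every matrix in `G`. -/
noncomputable def invariants {K : Type*} [Field K] {n : ℕ} (G : Set (GL (Fin n) K)) :
    Subalgebra K (MvPolynomial (Fin n) K) where
  carrier := {f | ∀ g ∈ G, matAct ((g : GL (Fin n) K) : Matrix (Fin n) (Fin n) K) f = f}
  mul_mem' := by
    intro a b ha hb g hg
    rw [map_mul, ha g hg, hb g hg]
  add_mem' := by
    intro a b ha hb g hg
    rw [map_add, ha g hg, hb g hg]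
  algebraMap_mem' := by
    intro c g hg
    simp [matAct]

/-- The ideal generated by the homogeneous `G`-invariants of positive degree;
the quotient by it is the algebra of coinvariants. -/
noncomputable def coinvIdeal {K : Type*} [Field K] {n : ℕ} (G : Set (GL (Fin n) K)) :
    Ideal (MvPolynomial (Fin n) K) :=
  Ideal.span {f | f ∈ invariants G ∧ ∃ d, 0 < d ∧ f.IsHomogeneous d}

/-- `tauf m s` is the largest partial sum `m i` which is `≤ s`; for `s` in the
`(j+1)`-st block this is `m j`. -/
def tauf {l : ℕ} (m : Fin (l + 1) → ℕ) (s : ℕ) : ℕ :=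
  ((Finset.univ : Finset (Fin (l + 1))).filter fun i => m i ≤ s).sup m

/-- `U_I`: block upper triangular matrices whose diagonal blocks are identity
matrices (blocks determined by the partial sums `m`). -/
def USet (K : Type*) [Field K] {l : ℕ} (n : ℕ) (m : Fin (l + 1) → ℕ) :
    Set (GL (Fin n) K) :=
  {g | ∀ s t : Fin n, tauf m (t : ℕ) ≤ tauf m (s : ℕ) →
    (g : Matrix (Fin n) (Fin n) K) s t = if s = t then 1 else 0}

/-- The global index of the `j`-th variable of the `i`-th block. -/
def emb {l : ℕ} (n : ℕ) (m : Fin (l + 1) → ℕ) (hmono : StrictMono m)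
    (hlast : m (Fin.last l) = n) (i : Fin l)
    (j : Fin (m i.succ - m i.castSucc)) : Fin n :=
  ⟨m i.castSucc + (j : ℕ), by
    have h1 : m i.succ ≤ n := hlast ▸ hmono.monotone (Fin.le_last _)
    have h2 := j.2
    omega⟩

/-- `G_I`: block upper triangular matrices whose `i`-th diagonal block lies in
`G i` (and whose entries above the diagonal blocks are arbitrary). -/
def GSet (K : Type*) [Field K] {l : ℕ} (n : ℕ) (m : Fin (l + 1) → ℕ)
    (hmono : StrictMono m) (hlast : m (Fin.last l) = n)
    (G : (i : Fin l) → Subgroup (GL (Fin (m i.succ - m i.castSucc)) K)) :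
    Set (GL (Fin n) K) :=
  {g | (∀ s t : Fin n, tauf m (t : ℕ) < tauf m (s : ℕ) →
          (g : Matrix (Fin n) (Fin n) K) s t = 0) ∧
    ∀ i : Fin l, ∃ h ∈ G i, ∀ j k : Fin (m i.succ - m i.castSucc),
      (g : Matrix (Fin n) (Fin n) K) (emb n m hmono hlast i j) (emb n m hmono hlast i k) =
        (h : Matrix (Fin (m i.succ - m i.castSucc)) (Fin (m i.succ - m i.castSucc)) K) j k}

/-- `Fpoly K k hk t = Π_{(λ_1,…,λ_k) ∈ K^k} (t + λ_1 x_1 + ⋯ + λ_k x_k)`. -/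
noncomputable def Fpoly (K : Type*) [Field K] [Fintype K] {n : ℕ} (k : ℕ) (hk : k ≤ n)
    (t : MvPolynomial (Fin n) K) : MvPolynomial (Fin n) K :=
  ∏ c : Fin k → K, (t + ∑ i : Fin k, C (c i) * X (Fin.castLE hk i))

/-- `v_{i,j} = F_{m_{i-1}}(x_{m_{i-1}+j})`. -/
noncomputable def vij (K : Type*) [Field K] [Fintype K] {l : ℕ} (n : ℕ)
    (m : Fin (l + 1) → ℕ) (hmono : StrictMono m) (hlast : m (Fin.last l) = n)
    (i : Fin l) (j : Fin (m i.succ - m i.castSucc)) : MvPolynomial (Fin n) K :=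
  Fpoly K (m i.castSucc)
    (le_trans (hmono.monotone (Fin.le_last _)) (le_of_eq hlast))
    (X (emb n m hmono hlast i j))

/-- A pseudo-reflection: a linear isomorphism which is not the identity but fixes
a hyperplane (a codimension-one subspace) pointwise. -/
def IsPseudoReflection {K : Type*} [Field K] {N : ℕ} (g : GL (Fin N) K) : Prop :=
  g ≠ 1 ∧ ∃ H : Submodule K (Fin N → K), Module.finrank K H = N - 1 ∧
    ∀ v ∈ H, Matrix.mulVec ((g : GL (Fin N) K) : Matrix (Fin N) (Fin N) K) v = v

section BlockIndex

variable {l n : ℕ} {m : Fin (l + 1) → ℕ}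

theorem tauf_emb (hmono : StrictMono m) (hlast : m (Fin.last l) = n) (i : Fin l)
    (j : Fin (m i.succ - m i.castSucc)) :
    tauf m (emb n m hmono hlast i j : ℕ) = m i.castSucc := by
  refine le_antisymm (Finset.sup_le fun a ha => ?_) (Finset.le_sup (f := m) ?_)
  · have ha : m a ≤ m i.castSucc + j := (Finset.mem_filter.1 ha).2
    exact hmono.monotone (Fin.le_castSucc_iff.2 (hmono.lt_iff_lt.1 (by omega)))
  · exact Finset.mem_filter.2 ⟨Finset.mem_univ _, Nat.le_add_right _ _⟩

theorem exists_emb_eq (hm0 : m 0 = 0) (hmono : StrictMono m) (hlast : m (Fin.last l) = n)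
    (s : Fin n) : ∃ i j, emb n m hmono hlast i j = s := by
  have key : ∀ k : Fin (l + 1), (s : ℕ) < m k →
      ∃ i : Fin l, m i.castSucc ≤ s ∧ (s : ℕ) < m i.succ := by
    intro k
    induction k using Fin.induction with
    | zero => intro h; omega
    | succ i ih =>
      intro h
      by_cases hs : (s : ℕ) < m i.castSucc
      · exact ih hs
      · exact ⟨i, by omega, h⟩
  obtain ⟨i, h1, h2⟩ := key (Fin.last l) (by omega)
  refine ⟨i, ⟨s - m i.castSucc, by omega⟩, Fin.ext ?_⟩
  simp only [emb]
  omega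

theorem emb_bijective (hm0 : m 0 = 0) (hmono : StrictMono m) (hlast : m (Fin.last l) = n) :
    Function.Bijective fun x : Σ i : Fin l, Fin (m i.succ - m i.castSucc) =>
      emb n m hmono hlast x.1 x.2 := by
  refine ⟨?_, fun s => ?_⟩
  · rintro ⟨i, j⟩ ⟨i', j'⟩ h
    replace h : emb n m hmono hlast i j = emb n m hmono hlast i' j' := h
    have hi : m i.castSucc = m i'.castSucc := by
      rw [← tauf_emb hmono hlast i j, h, tauf_emb]
    obtain rfl := Fin.castSucc_injective l (hmono.injective hi)
    have hj : (j : ℕ) = j' := by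
      have := congrArg Fin.val h
      simp only [emb] at this
      omega
    rw [Fin.ext hj]
  · obtain ⟨i, j, h⟩ := exists_emb_eq hm0 hmono hlast s
    exact ⟨⟨i, j⟩, h⟩

/-- The decomposition of `Fin n` into consecutive blocks, as an equivalence. -/
noncomputable def blockEquiv (hm0 : m 0 = 0) (hmono : StrictMono m)
    (hlast : m (Fin.last l) = n) : (Σ i : Fin l, Fin (m i.succ - m i.castSucc)) ≃ Fin n :=
  Equiv.ofBijective _ (emb_bijective hm0 hmono hlast)

end BlockIndex

theorem isPseudoReflection_iff_exists_dual {K : Type*} [Field K] {N : ℕ} (g : GL (Fin N) K) :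
    IsPseudoReflection g ↔ g ≠ 1 ∧ ∃ f : Module.Dual K (Fin N → K), f ≠ 0 ∧
      ∀ v, f v = 0 → Matrix.mulVec (g : Matrix (Fin N) (Fin N) K) v = v := by
  refine and_congr_right fun hg => ⟨?_, ?_⟩
  · rintro ⟨H, hH, hfix⟩
    have hlt : H < ⊤ := by
      refine lt_top_iff_ne_top.2 ?_
      rintro rfl
      refine hg (Units.ext (Matrix.ext_of_mulVec_single fun i => ?_))
      rw [hfix _ trivial, Units.val_one, Matrix.one_mulVec]
    obtain ⟨f, hf, hle⟩ := Submodule.exists_le_ker_of_lt_top H hlt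
    have hker := Module.Dual.finrank_ker_add_one_of_ne_zero hf
    rw [Module.finrank_fin_fun] at hker
    have heq : H = LinearMap.ker f := Submodule.eq_of_le_of_finrank_eq hle (by omega)
    exact ⟨f, hf, fun v hv => hfix v (by rwa [heq, LinearMap.mem_ker])⟩
  · rintro ⟨f, hf, hfix⟩
    have hker := Module.Dual.finrank_ker_add_one_of_ne_zero hf
    rw [Module.finrank_fin_fun] at hker
    exact ⟨LinearMap.ker f, by omega, fun v hv => hfix v hv⟩

theorem map_mem_of_forall_mem_closure {ι : Type*} [Finite ι] [DecidableEq ι] {Γ : ι → Type*}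
    [∀ i, Group (Γ i)] {H : Type*} [Group H] (D : (∀ i, Γ i) →* H) (P : Subgroup H)
    {S : ∀ i, Set (Γ i)} (hS : ∀ i, ∀ y ∈ S i, D (Pi.mulSingle i y) ∈ P)
    (h : ∀ i, Γ i) (hh : ∀ i, h i ∈ Subgroup.closure (S i)) : D h ∈ P := by
  have hpi : Subgroup.pi Set.univ (fun i => Subgroup.closure (S i)) ≤ P.comap D :=
    Subgroup.pi_le_iff.2 fun i => Subgroup.map_le_iff_le_comap.2 <|
      (Subgroup.closure_le _).2 (hS i)
  exact hpi fun i _ => hh i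

section Unipotent

variable {K : Type*} [Field K] {n : ℕ}

/-- If `N` is strictly upper triangular and `1 + N` is invertible, then `1 + N` is a product of
the transvections `1 + N e_t e_tᵀ`. -/
theorem mem_of_columns_mem (P : Subgroup (GL (Fin n) K)) (N : Matrix (Fin n) (Fin n) K)
    (hN : ∀ s t, t ≤ s → N s t = 0)
    (hP : ∀ (t : Fin n) (x : GL (Fin n) K),
      (x : Matrix (Fin n) (Fin n) K) = 1 + Matrix.of (fun a b => if b = t then N a b else 0) →
        x ∈ P)
    (g : GL (Fin n) K) (hg : (g : Matrix (Fin n) (Fin n) K) = 1 + N) : g ∈ P := by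
  let C : Fin n → Matrix (Fin n) (Fin n) K := fun t =>
    Matrix.of fun a b => if b = t then N a b else 0
  let T : ℕ → Matrix (Fin n) (Fin n) K := fun k =>
    Matrix.of fun a b => if (b : ℕ) < k then N a b else 0
  have hCT : ∀ (t : Fin n) (k : ℕ), k ≤ t + 1 → C t * T k = 0 := by
    intro t k hk
    ext a b
    rw [Matrix.mul_apply]
    refine Finset.sum_eq_zero fun c _ => ?_
    simp only [C, T, Matrix.of_apply]
    split_ifs with h1 h2
    · rw [hN c b (by rw [h1, Fin.le_def]; omega), mul_zero]
    all_goals simp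
  have hCC : ∀ t : Fin n, C t * C t = 0 := by
    intro t
    ext a b
    rw [Matrix.mul_apply]
    refine Finset.sum_eq_zero fun c _ => ?_
    simp only [C, Matrix.of_apply]
    split_ifs with h1 h2
    · rw [hN c b (by rw [h1, h2]), mul_zero]
    all_goals simp
  have key : ∀ k : ℕ, k ≤ n → ∃ x ∈ P, (x : Matrix (Fin n) (Fin n) K) = 1 + T k := by
    intro k
    induction k with
    | zero =>
      intro _
      refine ⟨1, P.one_mem, ?_⟩
      ext a b
      simp [T]
    | succ k ih =>
      intro hk
      obtain ⟨x, hx, hxT⟩ := ih (by omega)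
      let t : Fin n := ⟨k, hk⟩
      let c : GL (Fin n) K := ⟨1 + C t, 1 - C t,
        by rw [add_mul, mul_sub, mul_sub, hCC]; simp,
        by rw [sub_mul, mul_add, mul_add, hCC]; simp⟩
      refine ⟨c * x, P.mul_mem (hP t c rfl) hx, ?_⟩
      have hT : T (k + 1) = C t + T k := by
        ext a b
        simp only [T, C, t, Matrix.of_apply, Matrix.add_apply, Fin.ext_iff]
        rcases lt_trichotomy (b : ℕ) k with h | h | h
        · simp [h, h.ne, h.trans (Nat.lt_succ_self k)]
        · simp [h]
        · simp [h.ne', h.not_gt, show ¬ (b : ℕ) < k + 1 by omega]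
      rw [Units.val_mul, hxT, hT, show (c : Matrix (Fin n) (Fin n) K) = 1 + C t from rfl,
        add_mul, one_mul, mul_add, mul_one,
        hCT t k (Nat.le_succ k), add_zero]
      abel
  obtain ⟨x, hx, hxT⟩ := key n le_rfl
  have hgx : g = x := Units.ext <| by
    rw [hg, hxT]
    congr 1
    ext a b
    simp [T]
  rwa [hgx]

/-- A nontrivial matrix agreeing with the identity outside column `t` is a pseudo-reflection. -/
theorem isPseudoReflection_of_column (t : Fin n) (A : Matrix (Fin n) (Fin n) K)
    (x : GL (Fin n) K)
    (hx : (x : Matrix (Fin n) (Fin n) K) = 1 + Matrix.of (fun a b => if b = t then A a b else 0))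
    (hne : x ≠ 1) : IsPseudoReflection x := by
  refine (isPseudoReflection_iff_exists_dual x).2
    ⟨hne, LinearMap.proj t, fun h => ?_, fun v hv => ?_⟩
  · simpa using LinearMap.congr_fun h (Pi.single t 1)
  · rw [hx, Matrix.add_mulVec, Matrix.one_mulVec, add_eq_left]
    ext a
    simp only [Matrix.mulVec, dotProduct, Matrix.of_apply, ite_mul, zero_mul,
      Finset.sum_ite_eq', Finset.mem_univ, if_true]
    rw [show v t = 0 from hv]
    simp

end Unipotent

section BlockDiagonal

variable {K : Type*} [Field K] {l n : ℕ} {β : Fin l → ℕ}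

/-- The embedding of a product of general linear groups as block diagonal matrices. -/
noncomputable def blockDiagonalGL (e : (Σ i, Fin (β i)) ≃ Fin n) :
    ((i : Fin l) → GL (Fin (β i)) K) →* GL (Fin n) K :=
  (Units.map ((Matrix.reindexAlgEquiv K K e).toRingEquiv.toRingHom.comp
    (Matrix.blockDiagonal'RingHom (fun i => Fin (β i)) K)).toMonoidHom).comp
    (MulEquiv.piUnits (M := fun i => Matrix (Fin (β i)) (Fin (β i)) K)).symm.toMonoidHom

theorem blockDiagonalGL_apply (e : (Σ i, Fin (β i)) ≃ Fin n)
    (h : (i : Fin l) → GL (Fin (β i)) K) (x y : Σ i, Fin (β i)) :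
    (blockDiagonalGL e h : Matrix (Fin n) (Fin n) K) (e x) (e y) =
      Matrix.blockDiagonal' (fun i => (h i : Matrix (Fin (β i)) (Fin (β i)) K)) x y := by
  simp only [blockDiagonalGL, MonoidHom.comp_apply, Units.coe_map]
  change Matrix.blockDiagonal' _ (e.symm (e x)) (e.symm (e y)) = _
  simp only [Equiv.symm_apply_apply]
  rfl

theorem mul_blockDiagonalGL_apply (e : (Σ i, Fin (β i)) ≃ Fin n) (A : Matrix (Fin n) (Fin n) K)
    (h : (i : Fin l) → GL (Fin (β i)) K) (s : Fin n) (i : Fin l) (k : Fin (β i)) :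
    (A * (blockDiagonalGL e h : Matrix (Fin n) (Fin n) K)) s (e ⟨i, k⟩) =
      ∑ j, A s (e ⟨i, j⟩) * (h i : Matrix (Fin (β i)) (Fin (β i)) K) j k := by
  rw [Matrix.mul_apply, ← e.sum_comp, Fintype.sum_sigma, Finset.sum_eq_single i]
  · simp [blockDiagonalGL_apply]
  · intro i' _ hi'
    refine Finset.sum_eq_zero fun j _ => ?_
    rw [blockDiagonalGL_apply, Matrix.blockDiagonal'_apply_ne _ _ _ hi', mul_zero]
  · simp

theorem blockDiagonalGL_mulVec_apply (e : (Σ i, Fin (β i)) ≃ Fin n)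
    (h : (i : Fin l) → GL (Fin (β i)) K) (v : Fin n → K) (i : Fin l) (j : Fin (β i)) :
    Matrix.mulVec (blockDiagonalGL e h : Matrix (Fin n) (Fin n) K) v (e ⟨i, j⟩) =
      Matrix.mulVec (h i : Matrix (Fin (β i)) (Fin (β i)) K) (fun k => v (e ⟨i, k⟩)) j := by
  rw [Matrix.mulVec, dotProduct, ← e.sum_comp, Fintype.sum_sigma, Finset.sum_eq_single i]
  · simp [blockDiagonalGL_apply, Matrix.mulVec, dotProduct]
  · intro i' _ hi'
    refine Finset.sum_eq_zero fun k _ => ?_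
    rw [blockDiagonalGL_apply, Matrix.blockDiagonal'_apply_ne _ _ _ hi'.symm, zero_mul]
  · simp

theorem blockDiagonalGL_injective (e : (Σ i, Fin (β i)) ≃ Fin n) :
    Function.Injective (blockDiagonalGL (K := K) e) := by
  intro h h' heq
  funext i
  ext j k
  have := congrArg (fun g : GL (Fin n) K =>
    (g : Matrix (Fin n) (Fin n) K) (e ⟨i, j⟩) (e ⟨i, k⟩)) heq
  simpa [blockDiagonalGL_apply] using this

theorem isPseudoReflection_blockDiagonalGL_mulSingle (e : (Σ i, Fin (β i)) ≃ Fin n) (i : Fin l)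
    {x : GL (Fin (β i)) K} (hx : IsPseudoReflection x) :
    IsPseudoReflection (blockDiagonalGL e (Pi.mulSingle i x)) := by
  obtain ⟨hne, f, hf, hfix⟩ := (isPseudoReflection_iff_exists_dual x).1 hx
  refine (isPseudoReflection_iff_exists_dual _).2 ⟨fun h => hne ?_,
    f.comp (LinearMap.funLeft K K fun j => e ⟨i, j⟩), fun h => hf ?_, fun v hv => ?_⟩
  · rw [← map_one (blockDiagonalGL e)] at h
    exact Pi.mulSingle_eq_one_iff.1 (blockDiagonalGL_injective e h)
  · refine (LinearMap.cancel_right (LinearMap.funLeft_surjective_of_injective K K _ ?_)).1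
      (h.trans (LinearMap.zero_comp _).symm)
    exact e.injective.comp sigma_mk_injective
  · funext s
    obtain ⟨⟨i', j⟩, rfl⟩ := e.surjective s
    rw [blockDiagonalGL_mulVec_apply]
    rcases eq_or_ne i' i with rfl | hi
    · rw [Pi.mulSingle_eq_same]
      exact congrFun (hfix _ hv) j
    · rw [Pi.mulSingle_eq_of_ne hi, Units.val_one, Matrix.one_mulVec]

end BlockDiagonal

section GSet

variable {K : Type*} [Field K] {l n : ℕ} {m : Fin (l + 1) → ℕ}

theorem mem_GSet_iff (hm0 : m 0 = 0) (hmono : StrictMono m) (hlast : m (Fin.last l) = n)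
    (G : (i : Fin l) → Subgroup (GL (Fin (m i.succ - m i.castSucc)) K)) (g : GL (Fin n) K) :
    g ∈ GSet K n m hmono hlast G ↔
      (∀ x y, y.1 < x.1 → (g : Matrix (Fin n) (Fin n) K) (blockEquiv hm0 hmono hlast x)
        (blockEquiv hm0 hmono hlast y) = 0) ∧
      ∀ i, ∃ h ∈ G i, ∀ j k, (g : Matrix (Fin n) (Fin n) K) (blockEquiv hm0 hmono hlast ⟨i, j⟩)
        (blockEquiv hm0 hmono hlast ⟨i, k⟩) = (h : Matrix (Fin _) (Fin _) K) j k := by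
  refine and_congr_left fun _ => ?_
  rw [(blockEquiv hm0 hmono hlast).surjective.forall₂]
  refine forall₂_congr fun x y => ?_
  rw [show tauf m (blockEquiv hm0 hmono hlast x : ℕ) = m x.1.castSucc from tauf_emb hmono hlast _ _,
    show tauf m (blockEquiv hm0 hmono hlast y : ℕ) = m y.1.castSucc from tauf_emb hmono hlast _ _,
    hmono.lt_iff_lt, Fin.castSucc_lt_castSucc_iff]

theorem blockDiagonalGL_mem_GSet (hm0 : m 0 = 0) (hmono : StrictMono m)
    (hlast : m (Fin.last l) = n)
    (G : (i : Fin l) → Subgroup (GL (Fin (m i.succ - m i.castSucc)) K))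
    (h : (i : Fin l) → GL (Fin (m i.succ - m i.castSucc)) K) (hh : ∀ i, h i ∈ G i) :
    blockDiagonalGL (blockEquiv hm0 hmono hlast) h ∈ GSet K n m hmono hlast G := by
  refine (mem_GSet_iff hm0 hmono hlast G _).2 ⟨?_, fun i => ⟨h i, hh i, fun j k => ?_⟩⟩
  · rintro ⟨i, j⟩ ⟨i', k⟩ hlt
    rw [blockDiagonalGL_apply, Matrix.blockDiagonal'_apply_ne _ _ _ hlt.ne']
  · rw [blockDiagonalGL_apply, Matrix.blockDiagonal'_apply_eq]

theorem blockEquiv_lt (hm0 : m 0 = 0) (hmono : StrictMono m) (hlast : m (Fin.last l) = n)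
    {x y : Σ i : Fin l, Fin (m i.succ - m i.castSucc)} (hxy : x.1 < y.1) :
    blockEquiv hm0 hmono hlast x < blockEquiv hm0 hmono hlast y := by
  have h : m x.1.succ ≤ m y.1.castSucc := hmono.monotone (Fin.succ_le_castSucc_iff.2 hxy)
  have hx := x.2.2
  change m x.1.castSucc + (x.2 : ℕ) < m y.1.castSucc + (y.2 : ℕ)
  omega

/-- Matrices `1 + N` with `N` supported strictly above the diagonal blocks are products of
pseudo-reflections in `G_I`. -/
theorem mem_closure_of_block_unipotent (hm0 : m 0 = 0) (hmono : StrictMono m)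
    (hlast : m (Fin.last l) = n)
    (G : (i : Fin l) → Subgroup (GL (Fin (m i.succ - m i.castSucc)) K))
    (u : GL (Fin n) K)
    (hu : ∀ x y, y.1 ≤ x.1 → (u : Matrix (Fin n) (Fin n) K) (blockEquiv hm0 hmono hlast x)
      (blockEquiv hm0 hmono hlast y) = (1 : Matrix (Fin n) (Fin n) K)
        (blockEquiv hm0 hmono hlast x) (blockEquiv hm0 hmono hlast y)) :
    u ∈ Subgroup.closure
      {x : GL (Fin n) K | x ∈ GSet K n m hmono hlast G ∧ IsPseudoReflection x} := by
  set e := blockEquiv hm0 hmono hlast with he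
  set N : Matrix (Fin n) (Fin n) K := u - 1 with hN
  have hN0 : ∀ x y, y.1 ≤ x.1 → N (e x) (e y) = 0 := fun x y hxy => by
    rw [hN, Matrix.sub_apply, hu x y hxy, sub_self]
  refine mem_of_columns_mem _ N ?_ ?_ u (by rw [hN, add_sub_cancel])
  · rw [e.surjective.forall₂]
    intro x y hxy
    exact hN0 x y (not_lt.1 fun h => (blockEquiv_lt hm0 hmono hlast h).not_ge hxy)
  · intro t x hx
    by_cases hne : x = 1
    · rw [hne]
      exact Subgroup.one_mem _
    refine Subgroup.subset_closure ⟨?_, isPseudoReflection_of_column t N x hx hne⟩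
    have hx1 : ∀ a b, b.1 ≤ a.1 → (x : Matrix (Fin n) (Fin n) K) (e a) (e b) =
        (1 : Matrix (Fin n) (Fin n) K) (e a) (e b) := fun a b hab => by
      rw [hx, Matrix.add_apply, Matrix.of_apply, hN0 a b hab, ite_self, add_zero]
    refine (mem_GSet_iff hm0 hmono hlast G x).2
      ⟨fun a b hab => ?_, fun i => ⟨1, (G i).one_mem, fun j k => ?_⟩⟩
    · rw [hx1 a b hab.le, Matrix.one_apply_ne]
      exact (blockEquiv_lt hm0 hmono hlast hab).ne'
    · rw [hx1 ⟨i, j⟩ ⟨i, k⟩ le_rfl]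
      simp [Matrix.one_apply]

end GSet

/-- let `I = (n_1, …, n_l)` be a composition of `n` (encoded by its
strictly increasing partial sums `m : Fin (l+1) → ℕ`, `m 0 = 0`, `m l = n`) and
suppose each `G_i ≤ GL_{n_i}(F_q)` is generated by its pseudo-reflections.  Then
the block upper triangular group `G_I ≤ GL_n(F_q)` is generated by its
pseudo-reflections. -/
theorem statement0 {K : Type*} [Field K] [Fintype K] {p r : ℕ} (hp : p.Prime)
    (hr : 0 < r) (hcard : Fintype.card K = p ^ r)
    (n l : ℕ) (hl : 0 < l) (m : Fin (l + 1) → ℕ)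
    (hm0 : m 0 = 0) (hmono : StrictMono m) (hlast : m (Fin.last l) = n)
    (G : (i : Fin l) → Subgroup (GL (Fin (m i.succ - m i.castSucc)) K))
    (hG : ∀ i : Fin l, ∀ h ∈ G i,
      h ∈ Subgroup.closure {x | x ∈ G i ∧ IsPseudoReflection x}) :
    ∀ g : GL (Fin n) K, g ∈ GSet K n m hmono hlast G →
      g ∈ Subgroup.closure
        {x : GL (Fin n) K | x ∈ GSet K n m hmono hlast G ∧ IsPseudoReflection x} := by
  intro g hg
  set P := Subgroup.closure
    {x : GL (Fin n) K | x ∈ GSet K n m hmono hlast G ∧ IsPseudoReflection x}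
  let e := blockEquiv hm0 hmono hlast
  obtain ⟨htri, hdiag⟩ := (mem_GSet_iff hm0 hmono hlast G g).1 hg
  choose h hhG hgh using hdiag
  have hD : blockDiagonalGL e h ∈ P := by
    refine map_mem_of_forall_mem_closure (blockDiagonalGL e) P
      (fun i y hy => ?_) h (fun i => hG i (h i) (hhG i))
    refine Subgroup.subset_closure ⟨blockDiagonalGL_mem_GSet hm0 hmono hlast G _ fun i' => ?_,
      isPseudoReflection_blockDiagonalGL_mulSingle e i hy.2⟩
    rcases eq_or_ne i' i with rfl | hi
    · rw [Pi.mulSingle_eq_same]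
      exact hy.1
    · rw [Pi.mulSingle_eq_of_ne hi]
      exact (G i').one_mem
  suffices hu : g * blockDiagonalGL e h⁻¹ ∈ P by
    have hmul := P.mul_mem hu hD
    rwa [map_inv, inv_mul_cancel_right] at hmul
  refine mem_closure_of_block_unipotent hm0 hmono hlast G _ ?_
  rintro ⟨i, j⟩ ⟨i', k⟩ hle
  rw [Units.val_mul, mul_blockDiagonalGL_apply]
  rcases eq_or_lt_of_le (show i' ≤ i from hle) with rfl | hlt
  · simp_rw [e, hgh]
    rw [← Matrix.mul_apply, Pi.inv_apply, ← Units.val_mul, mul_inv_cancel]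
    simp [Matrix.one_apply]
  · rw [Matrix.one_apply_ne (blockEquiv_lt hm0 hmono hlast hlt).ne']
    exact Finset.sum_eq_zero fun j' _ => by rw [htri _ _ hlt, zero_mul]
end

section
/- For all 1 ≤ i ≤ n and 1 ≤ r ≤ n+1−i, the polynomial (x_{n+1−i} x_{n+2−i} ⋯ x_n)^{mr} · e_{n+1−i−r, n−i} lies in the ideal I of k[x_1, …, x_n] generated by e_1, …, e_n. -/
open MvPolynomial Finset

/-- `esubPow k n m j i` is the `j`-th elementary symmetric polynomial in
`x_1^m, …, x_i^m` inside `k[x_1, …, x_n]` (0-indexed variables `x_0, …, x_{i-1}`),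
with the convention `esubPow k n m 0 i = 1`. -/
noncomputable def esubPow (k : Type*) [CommRing k] (n m j i : ℕ) :
    MvPolynomial (Fin n) k :=
  ∑ S ∈ Finset.powersetCard j ((Finset.univ : Finset (Fin n)).filter fun s : Fin n => (s : ℕ) < i),
    ∏ s ∈ S, X s ^ m

section ElementarySymmetric

variable {R σ : Type*} [CommRing R]

/-- The `j`-th elementary symmetric sum of `y` over a finite set is the `j`-th coefficient of
`∏ (1 + y s T)`. -/
theorem coeff_prod_one_add_C_mul_X (A : Finset σ) (y : σ → R) (j : ℕ) :
    (∏ s ∈ A, (1 + Polynomial.C (y s) * Polynomial.X)).coeff j =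
      ∑ S ∈ powersetCard j A, ∏ s ∈ S, y s := by
  classical
  rw [Finset.prod_one_add, Polynomial.finsetSum_coeff, Finset.powersetCard_eq_filter,
    Finset.sum_filter]
  refine Finset.sum_congr rfl fun S _ => ?_
  rw [Finset.prod_mul_distrib, Finset.prod_const, ← map_prod, Polynomial.coeff_C_mul_X_pow]
  simp only [eq_comm]

/-- Elementary symmetric sums over a disjoint union. -/
theorem sum_powersetCard_union [DecidableEq σ] {A B : Finset σ} (h : Disjoint A B) (y : σ → R)
    (j : ℕ) :
    ∑ S ∈ powersetCard j (A ∪ B), ∏ s ∈ S, y s =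
      ∑ p ∈ antidiagonal j, (∑ S ∈ powersetCard p.1 A, ∏ s ∈ S, y s) *
        ∑ S ∈ powersetCard p.2 B, ∏ s ∈ S, y s := by
  simp only [← coeff_prod_one_add_C_mul_X]
  rw [Finset.prod_union h, Polynomial.coeff_mul]

/-- If an ideal contains all elementary symmetric sums over `A ∪ B` of positive degree, then it
contains `(∏_A y) ^ r * e_{|B| + 1 - r}(B)` for `1 ≤ r ≤ |B| + 1`. -/
theorem prod_pow_mul_esymm_mem [DecidableEq σ] {A B : Finset σ} (h : Disjoint A B)
    (hA : 0 < #A) (y : σ → R) (I : Ideal R)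
    (hI : ∀ j, 1 ≤ j → j ≤ #A + #B → ∑ S ∈ powersetCard j (A ∪ B), ∏ s ∈ S, y s ∈ I)
    (r : ℕ) (hr : 1 ≤ r) (hrB : r ≤ #B + 1) :
    (∏ s ∈ A, y s) ^ r * ∑ S ∈ powersetCard (#B + 1 - r) B, ∏ s ∈ S, y s ∈ I := by
  induction r using Nat.strong_induction_on with
  | _ r ih =>
  have hmem := I.mul_mem_left ((∏ s ∈ A, y s) ^ (r - 1))
    (hI (#A + (#B + 1 - r)) (by omega) (by omega))
  rw [sum_powersetCard_union h,
    ← Finset.add_sum_erase _ _ (show (#A, #B + 1 - r) ∈ antidiagonal (#A + (#B + 1 - r)) by simp),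
    mul_add, powersetCard_self, sum_singleton, ← mul_assoc, ← pow_succ,
    Nat.sub_add_cancel hr] at hmem
  refine (Ideal.add_mem_iff_left I ?_).1 hmem
  rw [Finset.mul_sum]
  refine I.sum_mem fun p hp => ?_
  obtain ⟨a, b⟩ := p
  simp only [mem_erase, HasAntidiagonal.mem_antidiagonal, ne_eq, Prod.mk.injEq] at hp
  obtain ⟨hne, hab⟩ := hp
  rcases lt_or_ge #A a with ha | ha
  · simp [powersetCard_eq_empty.2 ha]
  rcases lt_or_ge #B b with hb | hb
  · simp [powersetCard_eq_empty.2 hb]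
  have hk := ih (#B + 1 - b) (by omega) (by omega) (by omega)
  rw [show #B + 1 - (#B + 1 - b) = b by omega] at hk
  have hsplit : r - 1 = (r - 1 - (#B + 1 - b)) + (#B + 1 - b) := by omega
  rw [hsplit, pow_add, mul_assoc, mul_left_comm ((∏ s ∈ A, y s) ^ (#B + 1 - b))]
  exact I.mul_mem_left _ (I.mul_mem_left _ hk)

end ElementarySymmetric

/-- for `1 ≤ i ≤ n` and `1 ≤ r ≤ n + 1 - i`, the polynomial
`(x_{n+1-i} ⋯ x_n)^{mr} · e_{n+1-i-r, n-i}` lies in the ideal generated by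
`e_1, …, e_n` (the elementary symmetric polynomials in `x_1^m, …, x_n^m`). -/
theorem statement3 {k : Type*} [Field k] (n m : ℕ) (hn : 1 ≤ n) (hm : 1 ≤ m)
    (I : Ideal (MvPolynomial (Fin n) k))
    (hI : I = Ideal.span {f | ∃ j, 1 ≤ j ∧ j ≤ n ∧ f = esubPow k n m j n}) :
    ∀ i r : ℕ, 1 ≤ i → i ≤ n → 1 ≤ r → r ≤ n + 1 - i →
      (∏ s ∈ (Finset.univ : Finset (Fin n)).filter fun s : Fin n => n - i ≤ (s : ℕ),
          X s ^ (m * r)) * esubPow k n m (n + 1 - i - r) (n - i) ∈ I := by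
  intro i r hi hin hr hrn
  set A := (Finset.univ : Finset (Fin n)).filter fun s : Fin n => n - i ≤ (s : ℕ) with hA
  set B := (Finset.univ : Finset (Fin n)).filter fun s : Fin n => (s : ℕ) < n - i with hB
  have hdisj : Disjoint A B := by
    rw [Finset.disjoint_left]
    intro s hs hs'
    simp only [hA, hB, mem_filter, mem_univ, true_and] at hs hs'
    omega
  have hunion : A ∪ B = univ.filter fun s : Fin n => (s : ℕ) < n := by
    ext s
    simp only [hA, hB, mem_union, mem_filter, mem_univ, true_and]
    omega
  have hcardB : #B = n - i := by
    rw [hB, Fin.card_filter_val_lt]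
    omega
  have hcard : #A + #B = n := by
    rw [← card_union_of_disjoint hdisj, hunion]
    simp
  have key := prod_pow_mul_esymm_mem hdisj (by omega)
    (fun s => (X s ^ m : MvPolynomial (Fin n) k)) I
    (fun j hj hjn => by
      rw [hunion, hI]
      exact Ideal.subset_span ⟨j, hj, hcard ▸ hjn, rfl⟩) r hr (by omega)
  rw [← Finset.prod_pow, hcardB, show n - i + 1 - r = n + 1 - i - r by omega] at key
  simpa only [← pow_mul, esubPow] using key
end

section
/- For every 1 ≤ r ≤ n, the monomial (x_r x_{r+1} ⋯ x_n)^{mr} lies in the ideal I of k[x_1, …, x_n] generated by e_1, …, e_n. -/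
open MvPolynomial Finset

/-- `esymmPow k n m j` is the `j`-th elementary symmetric polynomial in
`x_1^m, …, x_n^m` inside `k[x_1, …, x_n]`. -/
noncomputable def esymmPow (k : Type*) [CommRing k] (n m j : ℕ) :
    MvPolynomial (Fin n) k :=
  ∑ S ∈ Finset.powersetCard j (Finset.univ : Finset (Fin n)), ∏ s ∈ S, X s ^ m

/-- If `f * g = 1` and `f` has degree at most `p` with `1 ≤ p`, then high powers of the coefficient
of `X ^ p` in `f` annihilate the coefficients of `g`. -/
lemma Polynomial.coeff_pow_mul_coeff_eq_zero {A : Type*} [CommRing A] {f g : Polynomial A}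
    (h : f * g = 1) {p q : ℕ} (hp : 1 ≤ p) (hf : f.natDegree ≤ p) (hg : g.natDegree ≤ q) :
    ∀ j i : ℕ, q < i + j → f.coeff p ^ j * g.coeff i = 0 := by
  intro j
  induction j with
  | zero =>
    intro i hi
    rw [Polynomial.coeff_eq_zero_of_natDegree_lt (p := g) (by omega), mul_zero]
  | succ j ih =>
    intro i hi
    have hc : (f * g).coeff (p + i) = 0 := by
      rw [h, Polynomial.coeff_one, if_neg (by omega)]
    have hs : f.coeff p ^ j * (f * g).coeff (p + i) =
        f.coeff p ^ j * (f.coeff p * g.coeff i) := by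
      rw [Polynomial.coeff_mul, Finset.mul_sum]
      refine Finset.sum_eq_single (p, i) ?_ (by simp)
      rintro ⟨u, v⟩ huv hne
      rw [Finset.HasAntidiagonal.mem_antidiagonal] at huv
      rcases lt_trichotomy u p with hu | rfl | hu
      · rw [mul_left_comm, ih v (by dsimp only at huv; omega), mul_zero]
      · exact absurd (by simpa using huv) (fun hv : v = i => hne (by rw [hv]))
      · rw [Polynomial.coeff_eq_zero_of_natDegree_lt (p := f) (n := u) (by omega), zero_mul, mul_zero]
    rw [pow_succ, mul_assoc, ← hs, hc, mul_zero]

lemma Polynomial.natDegree_prod_one_add_C_mul_X_le {A ι : Type*} [CommRing A] (s : Finset ι)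
    (y : ι → A) :
    (∏ i ∈ s, (1 + Polynomial.C (y i) * Polynomial.X)).natDegree ≤ s.card := by
  have hi (i : ι) : (1 + Polynomial.C (y i) * Polynomial.X).natDegree ≤ 1 := by compute_degree
  refine (Polynomial.natDegree_prod_le _ _).trans ?_
  simpa using Finset.sum_le_sum fun i (_ : i ∈ s) => hi i

lemma Polynomial.coeff_card_prod_one_add_C_mul_X {A ι : Type*} [CommRing A] (s : Finset ι)
    (y : ι → A) :
    (∏ i ∈ s, (1 + Polynomial.C (y i) * Polynomial.X)).coeff s.card = ∏ i ∈ s, y i := by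
  have hi (i : ι) : (1 + Polynomial.C (y i) * Polynomial.X).natDegree ≤ 1 := by compute_degree
  have := Polynomial.coeff_prod_of_natDegree_le s
    (fun i => 1 + Polynomial.C (y i) * Polynomial.X) 1 fun i _ => hi i
  simpa [Polynomial.coeff_one] using this

lemma Polynomial.prod_one_add_C_mul_X {A ι : Type*} [CommRing A] (s : Finset ι) (y : ι → A) :
    ∏ i ∈ s, (1 + Polynomial.C (y i) * Polynomial.X) =
      ∑ j ∈ Finset.range (s.card + 1),
        Polynomial.C (∑ t ∈ s.powersetCard j, ∏ i ∈ t, y i) * Polynomial.X ^ j := by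
  rw [Finset.prod_one_add, Finset.sum_powerset]
  refine Finset.sum_congr rfl fun j _ => ?_
  rw [map_sum, Finset.sum_mul]
  refine Finset.sum_congr rfl fun t ht => ?_
  rw [Finset.prod_mul_distrib, Finset.prod_const, (Finset.mem_powersetCard.1 ht).2, map_prod]

/-- If the elementary symmetric functions of positive degree of a family vanish, then so does the
power `#sᶜ + 1` of the product of the family over any nonempty `s`. -/
lemma Finset.prod_pow_card_compl_add_one_eq_zero {A ι : Type*} [CommRing A] [Fintype ι]
    [DecidableEq ι] (y : ι → A)
    (hy : ∀ j, 1 ≤ j → j ≤ Fintype.card ι →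
      ∑ t ∈ (Finset.univ : Finset ι).powersetCard j, ∏ i ∈ t, y i = 0)
    (s : Finset ι) (hs : s.Nonempty) :
    (∏ i ∈ s, y i) ^ (sᶜ.card + 1) = 0 := by
  have h : (∏ i ∈ s, (1 + Polynomial.C (y i) * Polynomial.X)) *
      ∏ i ∈ sᶜ, (1 + Polynomial.C (y i) * Polynomial.X) = 1 := by
    rw [Finset.prod_mul_prod_compl, Polynomial.prod_one_add_C_mul_X, Finset.sum_range_succ',
      Finset.sum_eq_zero]
    · simp
    · intro j hj
      rw [Finset.mem_range, Finset.card_univ] at hj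
      rw [hy (j + 1) (by omega) (by omega), map_zero, zero_mul]
  have := Polynomial.coeff_pow_mul_coeff_eq_zero h hs.card_pos
    (Polynomial.natDegree_prod_one_add_C_mul_X_le s y)
    (Polynomial.natDegree_prod_one_add_C_mul_X_le sᶜ y) (sᶜ.card + 1) 0 (by omega)
  rw [Polynomial.coeff_card_prod_one_add_C_mul_X] at this
  simpa [Polynomial.coeff_zero_prod] using this

/-- for every `1 ≤ r ≤ n`, the monomial `(x_r x_{r+1} ⋯ x_n)^{mr}`
lies in the ideal generated by `e_1, …, e_n`, the elementary symmetric
polynomials in `x_1^m, …, x_n^m`. -/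
theorem statement4 {k : Type*} [Field k] (n m : ℕ) (hn : 1 ≤ n) (hm : 1 ≤ m)
    (I : Ideal (MvPolynomial (Fin n) k))
    (hI : I = Ideal.span {f | ∃ j, 1 ≤ j ∧ j ≤ n ∧ f = esymmPow k n m j}) :
    ∀ r : ℕ, 1 ≤ r → r ≤ n →
      (∏ s ∈ (Finset.univ : Finset (Fin n)).filter fun s : Fin n => r - 1 ≤ (s : ℕ),
          X s ^ (m * r)) ∈ I := by
  intro r hr hrn
  set s := (Finset.univ : Finset (Fin n)).filter fun s : Fin n => r - 1 ≤ (s : ℕ) with hs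
  have hcard : sᶜ.card + 1 = r := by
    have : sᶜ = Finset.Iio (⟨r - 1, by omega⟩ : Fin n) := by
      ext i
      simp only [hs, Finset.mem_compl, Finset.mem_filter_univ, Finset.mem_Iio, Fin.lt_def, not_le]
    rw [this, Fin.card_Iio]
    exact Nat.sub_add_cancel hr
  have hne : s.Nonempty := ⟨⟨r - 1, by omega⟩, (Finset.mem_filter_univ _).2 le_rfl⟩
  have key := Finset.prod_pow_card_compl_add_one_eq_zero
    (fun i : Fin n => Ideal.Quotient.mk I (X i ^ m)) (fun j hj hjn => by
      have hmem : esymmPow k n m j ∈ I := by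
        rw [hI]
        exact Ideal.subset_span ⟨j, hj, by simpa using hjn, rfl⟩
      simpa only [esymmPow, map_sum, map_prod] using Ideal.Quotient.eq_zero_iff_mem.2 hmem) s hne
  rw [hcard, ← map_prod, ← map_pow, Ideal.Quotient.eq_zero_iff_mem, ← Finset.prod_pow] at key
  simpa only [pow_mul] using key
end

section
/- The monomial α = x_1^{m−1} x_2^{2m−1} ⋯ x_n^{mn−1} generates a block basis for P/I: the set of all monomial factors of α projects to a k-vector-space basis of k[x_1, …, x_n]/I, where I is the ideal generated by e_1, …, e_n. (This is the block basis for the coinvariant algebra of the imprimitive reflection group G(m,1,n).) -/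
open MvPolynomial Finset

universe u

/-- The monomial `∏ y_i ^ b_i` with `b_i < m (i + 1)`. -/
def blockMonomial {B : Type*} [CommRing B] {n : ℕ} (m : ℕ) (y : Fin n → B)
    (b : (i : Fin n) → Fin (m * (i + 1))) : B :=
  ∏ i, y i ^ (b i : ℕ)

/-- The product of the linear factors `T - y_i ^ m`. -/
noncomputable def powProd {B : Type*} [CommRing B] {n : ℕ} (m : ℕ) (y : Fin n → B) :
    Polynomial B :=
  ∏ i, (Polynomial.X - Polynomial.C (y i ^ m))

theorem blockMonomial_snocEquiv {B : Type*} [CommRing B] {n m : ℕ} (y : Fin (n + 1) → B)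
    (b : Fin (m * (n + 1)) × ((i : Fin n) → Fin (m * (i + 1)))) :
    blockMonomial m y (Fin.snocEquiv (fun i : Fin (n + 1) => Fin (m * (i + 1))) b) =
      y (Fin.last n) ^ (b.1 : ℕ) * blockMonomial m (fun i => y i.castSucc) b.2 := by
  simp [blockMonomial, Fin.prod_univ_castSucc, Fin.snocEquiv, mul_comm]

theorem powProd_succ {B : Type*} [CommRing B] {n m : ℕ} (y : Fin (n + 1) → B) :
    powProd m y = (Polynomial.X - Polynomial.C (y (Fin.last n) ^ m)) *
      powProd m (fun i => y i.castSucc) := by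
  rw [powProd, Fin.prod_univ_castSucc, mul_comm, powProd]

theorem linearIndependent_root_pow {R : Type*} [CommRing R] {g : Polynomial R} (hg : g.Monic)
    {d : ℕ} (hd : g.natDegree = d) :
    LinearIndependent R (fun j : Fin d => AdjoinRoot.root g ^ (j : ℕ)) := by
  subst hd
  have h := (AdjoinRoot.powerBasis' hg).basis.linearIndependent
  rw [PowerBasis.coe_basis] at h
  exact h

theorem span_root_pow {R : Type*} [CommRing R] {g : Polynomial R} (hg : g.Monic)
    {d : ℕ} (hd : g.natDegree = d) :
    Submodule.span R (Set.range fun j : Fin d => AdjoinRoot.root g ^ (j : ℕ)) = ⊤ := by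
  subst hd
  have h := (AdjoinRoot.powerBasis' hg).basis.span_eq
  rw [PowerBasis.coe_basis] at h
  exact h

/-- Over the ring obtained by adjoining a root `ρ` of `p (T ^ m)`, the polynomial `p` is divisible
by `T - ρ ^ m`. -/
theorem exists_adjoinRoot_factor {R : Type*} [CommRing R] {m n : ℕ} (hm : 1 ≤ m)
    {p : Polynomial R} (hp : p.Monic) (hn : p.natDegree = n + 1) :
    ∃ q : Polynomial (AdjoinRoot (Polynomial.expand R m p)), q.Monic ∧ q.natDegree = n ∧
      p.map (algebraMap R _) = (Polynomial.X -
        Polynomial.C (AdjoinRoot.root (Polynomial.expand R m p) ^ m)) * q := by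
  have hg : (Polynomial.expand R m p).Monic := hp.expand hm
  have hR : Nontrivial R := by
    by_contra h
    rw [not_nontrivial_iff_subsingleton] at h
    simp [Polynomial.natDegree_of_subsingleton] at hn
  have hdim : 0 < (Polynomial.expand R m p).natDegree := by
    rw [Polynomial.natDegree_expand, hn]; positivity
  have : Nontrivial (AdjoinRoot (Polynomial.expand R m p)) :=
    nontrivial_of_ne _ _ ((linearIndependent_root_pow hg rfl).ne_zero ⟨0, hdim⟩)
  have hroot : (p.map (algebraMap R (AdjoinRoot (Polynomial.expand R m p)))).IsRoot
      (AdjoinRoot.root (Polynomial.expand R m p) ^ m) := by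
    rw [Polynomial.IsRoot.def, Polynomial.eval_map_algebraMap, ← Polynomial.expand_aeval,
      AdjoinRoot.aeval_eq, AdjoinRoot.mk_self]
  have heq := Polynomial.mul_divByMonic_eq_iff_isRoot.2 hroot
  have hX := Polynomial.monic_X_sub_C (AdjoinRoot.root (Polynomial.expand R m p) ^ m)
  have hq := hX.of_mul_monic_left (heq ▸ hp.map _)
  refine ⟨_, hq, ?_, heq.symm⟩
  have hdeg := congrArg Polynomial.natDegree heq
  rw [hX.natDegree_mul hq, hp.natDegree_map, hn, Polynomial.natDegree_X_sub_C] at hdeg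
  omega

theorem adjoin_castSucc_eq_top {R S B : Type*} [CommRing R] [CommRing S] [CommRing B]
    [Algebra R S] [Algebra R B] [Algebra S B] [IsScalarTower R S B] {n : ℕ} (y : Fin (n + 1) → B)
    {s : S} (hs : algebraMap S B s = y (Fin.last n))
    (hgen : Algebra.adjoin R (Set.range y) = ⊤) :
    Algebra.adjoin S (Set.range fun i : Fin n => y i.castSucc) = ⊤ := by
  have h : Algebra.adjoin R (Set.range y) ≤
      (Algebra.adjoin S (Set.range fun i : Fin n => y i.castSucc)).restrictScalars R := by
    rw [Algebra.adjoin_le_iff]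
    rintro _ ⟨i, rfl⟩
    rw [Subalgebra.coe_restrictScalars, SetLike.mem_coe]
    induction i using Fin.lastCases with
    | last =>
      rw [← hs]
      exact Subalgebra.algebraMap_mem (Algebra.adjoin S _) s
    | cast i => exact Algebra.subset_adjoin (Set.mem_range_self i)
  rw [hgen] at h
  exact eq_top_iff.2 fun x _ => h Algebra.mem_top

theorem span_blockMonomial {n m : ℕ} (hm : 1 ≤ m) {R B : Type*} [CommRing R] [CommRing B]
    [Algebra R B] {p : Polynomial R} (hp : p.Monic) (hn : p.natDegree = n) (y : Fin n → B)
    (hy : powProd m y = p.map (algebraMap R B)) (hgen : Algebra.adjoin R (Set.range y) = ⊤) :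
    Submodule.span R (Set.range (blockMonomial m y)) = ⊤ := by
  induction n generalizing R with
  | zero =>
    rw [eq_top_iff]
    rintro x -
    have hx : x ∈ Algebra.adjoin R (Set.range y) := hgen ▸ Algebra.mem_top
    rw [Set.range_eq_empty, Algebra.adjoin_empty, Algebra.mem_bot] at hx
    obtain ⟨r, rfl⟩ := hx
    rw [Algebra.algebraMap_eq_smul_one]
    exact Submodule.smul_mem _ _ (Submodule.subset_span ⟨finZeroElim, by simp [blockMonomial]⟩)
  | succ n ih =>
    obtain ⟨q, hq, hqn, hpq⟩ := exists_adjoinRoot_factor hm hp hn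
    have hroot : Polynomial.eval₂ (algebraMap R B) (y (Fin.last n))
        (Polynomial.expand R m p) = 0 := by
      rw [← Polynomial.aeval_def, Polynomial.expand_aeval, ← Polynomial.eval_map_algebraMap, ← hy,
        powProd_succ]
      simp
    let φ : AdjoinRoot (Polynomial.expand R m p) →ₐ[R] B :=
      AdjoinRoot.liftAlgHom _ (Algebra.ofId R B) (y (Fin.last n)) hroot
    have hφ : φ (AdjoinRoot.root _) = y (Fin.last n) := AdjoinRoot.liftAlgHom_root ..
    let _ : Algebra (AdjoinRoot (Polynomial.expand R m p)) B := φ.toAlgebra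
    have : IsScalarTower R (AdjoinRoot (Polynomial.expand R m p)) B :=
      IsScalarTower.of_algebraMap_eq' φ.comp_algebraMap.symm
    have hy' : powProd m (fun i => y i.castSucc) = q.map (algebraMap _ B) := by
      have h : p.map (algebraMap R B) =
          (p.map (algebraMap R (AdjoinRoot (Polynomial.expand R m p)))).map (algebraMap _ B) := by
        rw [Polynomial.map_map, ← IsScalarTower.algebraMap_eq]
      rw [h, hpq, powProd_succ] at hy
      apply (Polynomial.monic_X_sub_C (y (Fin.last n) ^ m)).isRegular.left
      simpa [RingHom.algebraMap_toAlgebra, hφ] using hy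
    have hgen' : Algebra.adjoin (AdjoinRoot (Polynomial.expand R m p))
        (Set.range fun i : Fin n => y i.castSucc) = ⊤ :=
      adjoin_castSucc_eq_top y hφ hgen
    have hspan := Submodule.span_smul_of_span_eq_top
      (span_root_pow (hp.expand hm) (d := m * (n + 1))
        (by rw [Polynomial.natDegree_expand, hn, mul_comm]))
      (Set.range (blockMonomial m fun i => y i.castSucc))
    rw [ih hq hqn _ hy' hgen', Submodule.restrictScalars_top] at hspan
    rw [eq_top_iff, ← hspan]
    apply Submodule.span_mono
    rintro _ ⟨_, ⟨j, rfl⟩, _, ⟨b, rfl⟩, rfl⟩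
    refine ⟨Fin.snocEquiv (fun i : Fin (n + 1) => Fin (m * (i + 1))) (j, b), ?_⟩
    rw [blockMonomial_snocEquiv]
    simp [Algebra.smul_def, RingHom.algebraMap_toAlgebra, hφ]

theorem exists_linearIndependent_blockMonomial {n m : ℕ} (hm : 1 ≤ m) {R : Type u} [CommRing R]
    {p : Polynomial R} (hp : p.Monic) (hn : p.natDegree = n) :
    ∃ (A : Type u) (_ : CommRing A) (_ : Algebra R A) (x : Fin n → A),
      powProd m x = p.map (algebraMap R A) ∧ LinearIndependent R (blockMonomial m x) := by
  induction n generalizing R with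
  | zero =>
    refine ⟨R, inferInstance, inferInstance, finZeroElim, ?_, ?_⟩
    · simp [powProd, hp.natDegree_eq_zero.1 hn]
    · rw [Fintype.linearIndependent_iff]
      intro g hg b
      simpa [blockMonomial, Subsingleton.elim b default] using hg
  | succ n ih =>
    obtain ⟨q, hq, hqn, hpq⟩ := exists_adjoinRoot_factor hm hp hn
    obtain ⟨A, _, _, x, hx, hli⟩ := ih hq hqn
    let _ : Algebra R A := Algebra.compHom A
      (algebraMap R (AdjoinRoot (Polynomial.expand R m p)))
    have : IsScalarTower R (AdjoinRoot (Polynomial.expand R m p)) A :=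
      IsScalarTower.of_algebraMap_eq' rfl
    let y : Fin (n + 1) → A :=
      Fin.snoc x (algebraMap _ A (AdjoinRoot.root (Polynomial.expand R m p)))
    have hy : (fun i : Fin n => y i.castSucc) = x := by ext; simp [y]
    have hlast : y (Fin.last n) = algebraMap _ A (AdjoinRoot.root (Polynomial.expand R m p)) := by
      simp [y]
    refine ⟨A, inferInstance, inferInstance, y, ?_, ?_⟩
    · rw [powProd_succ, hy, hx, hlast,
        IsScalarTower.algebraMap_eq R (AdjoinRoot (Polynomial.expand R m p)) A,
        ← Polynomial.map_map, hpq]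
      simp
    · have h := linearIndependent_smul (linearIndependent_root_pow (hp.expand hm)
        (d := m * (n + 1)) (by rw [Polynomial.natDegree_expand, hn, mul_comm])) hli
      have hcomp : blockMonomial m y ∘
          Fin.snocEquiv (fun i : Fin (n + 1) => Fin (m * (i + 1))) =
          fun b : Fin (m * (n + 1)) × ((i : Fin n) → Fin (m * (i + 1))) =>
            AdjoinRoot.root (Polynomial.expand R m p) ^ (b.1 : ℕ) • blockMonomial m x b.2 := by
        funext b
        exact (blockMonomial_snocEquiv y b).trans
          (by rw [hy, hlast, Algebra.smul_def, map_pow])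
      rw [← linearIndependent_equiv (Fin.snocEquiv fun i : Fin (n + 1) => Fin (m * (i + 1)))]
      exact hcomp ▸ h

theorem aeval_esymmPow {k A : Type*} [CommRing k] [CommRing A] [Algebra k A] {n : ℕ}
    (m j : ℕ) (y : Fin n → A) :
    aeval y (esymmPow k n m j) = (univ.val.map fun i => y i ^ m).esymm j := by
  rw [Finset.esymm_map_val]
  simp [esymmPow]

theorem powProd_eq_multiset_prod {A : Type*} [CommRing A] {n : ℕ} (m : ℕ) (y : Fin n → A) :
    powProd m y = ((univ.val.map fun i => y i ^ m).map
      fun t => Polynomial.X - Polynomial.C t).prod := by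
  rw [Multiset.map_map]
  rfl

theorem powProd_eq_X_pow_iff {k A : Type*} [CommRing k] [CommRing A] [Algebra k A] {n m : ℕ}
    (y : Fin n → A) :
    powProd m y = Polynomial.X ^ n ↔
      ∀ j, 1 ≤ j → j ≤ n → aeval y (esymmPow k n m j) = 0 := by
  have hcard : (univ.val.map fun i => y i ^ m).card = n := by simp
  simp only [aeval_esymmPow, powProd_eq_multiset_prod]
  constructor
  · intro h j hj hjn
    have hc := Multiset.prod_X_sub_C_coeff (univ.val.map fun i => y i ^ m) (k := n - j)
      (by rw [hcard]; omega)
    rw [h, hcard, Nat.sub_sub_self hjn, Polynomial.coeff_X_pow, if_neg (by omega)] at hc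
    exact (((isUnit_one.neg).pow j).mul_right_eq_zero).1 hc.symm
  · intro h
    rw [Multiset.prod_X_sub_X_eq_sum_esymm, hcard, Finset.sum_eq_single 0]
    · simp [Multiset.esymm]
    · intro j hj hj0
      rw [h j (by omega) (by simpa [Nat.lt_succ_iff] using hj)]
      simp
    · simp

/-- Exponent vectors bounded by `m (s + 1) - 1`, as elements of a product of `Fin`s. -/
def boundedExponentEquiv {n m : ℕ} (hm : 1 ≤ m) :
    {b : Fin n → ℕ // ∀ s : Fin n, b s ≤ m * ((s : ℕ) + 1) - 1} ≃
      ((i : Fin n) → Fin (m * (i + 1))) where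
  toFun b i := ⟨b.1 i, (Nat.le_sub_one_iff_lt (by positivity)).1 (b.2 i)⟩
  invFun b := ⟨fun i => b i, fun i => Nat.le_sub_one_of_lt (b i).2⟩
  left_inv _ := rfl
  right_inv _ := rfl

/-- the monomial `α = x_1^{m-1} x_2^{2m-1} ⋯ x_n^{mn-1}` generates a
block basis for `P/I`: the family of all monomial factors of `α` (indexed by the
exponent vectors `b ≤ (m·1-1, …, m·n-1)`) projects to a `k`-vector-space basis of
`k[x_1, …, x_n]/I`, where `I` is the ideal generated by the elementary symmetric
polynomials `e_1, …, e_n` in `x_1^m, …, x_n^m`. -/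
theorem statement5 {k : Type*} [Field k] (n m : ℕ) (hn : 1 ≤ n) (hm : 1 ≤ m)
    (I : Ideal (MvPolynomial (Fin n) k))
    (hI : I = Ideal.span {f | ∃ j, 1 ≤ j ∧ j ≤ n ∧ f = esymmPow k n m j}) :
    LinearIndependent k
      (fun b : {b : Fin n → ℕ // ∀ s : Fin n, b s ≤ m * ((s : ℕ) + 1) - 1} =>
        Ideal.Quotient.mk I (∏ s : Fin n, X s ^ b.1 s)) ∧
    Submodule.span k
      (Set.range (fun b : {b : Fin n → ℕ // ∀ s : Fin n, b s ≤ m * ((s : ℕ) + 1) - 1} =>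
        Ideal.Quotient.mk I (∏ s : Fin n, X s ^ b.1 s))) = ⊤ := by
  set y : Fin n → MvPolynomial (Fin n) k ⧸ I := fun i => Ideal.Quotient.mk I (X i) with hy
  have hmk : aeval y = Ideal.Quotient.mkₐ k I := by ext i; simp [hy]
  have hfam : (fun b : {b : Fin n → ℕ // ∀ s : Fin n, b s ≤ m * ((s : ℕ) + 1) - 1} =>
      Ideal.Quotient.mk I (∏ s : Fin n, X s ^ b.1 s)) =
      blockMonomial m y ∘ boundedExponentEquiv hm := by
    ext b
    simp [blockMonomial, boundedExponentEquiv, hy]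
  rw [hfam, linearIndependent_equiv, EquivLike.range_comp]
  have hX : (Polynomial.X ^ n : Polynomial k).Monic := Polynomial.monic_X_pow n
  have hdeg : (Polynomial.X ^ n : Polynomial k).natDegree = n := Polynomial.natDegree_X_pow n
  constructor
  · obtain ⟨A, _, _, x, hx, hli⟩ := exists_linearIndependent_blockMonomial hm hX hdeg
    rw [Polynomial.map_pow, Polynomial.map_X, powProd_eq_X_pow_iff (k := k)] at hx
    have hker : ∀ f ∈ I, aeval (R := k) x f = 0 := by
      have h : I ≤ RingHom.ker (aeval (R := k) x) := by
        rw [hI, Ideal.span_le]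
        rintro _ ⟨j, hj, hjn, rfl⟩
        exact hx j hj hjn
      exact h
    apply LinearIndependent.of_comp (Ideal.Quotient.liftₐ I (aeval x) hker).toLinearMap
    convert hli using 1
    ext b
    have hlift (i : Fin n) : Ideal.Quotient.liftₐ I (aeval (R := k) x) hker (y i) = x i := by
      exact aeval_X x i
    simp only [blockMonomial, Function.comp_apply, AlgHom.toLinearMap_apply, map_prod, map_pow,
      hlift]
  · refine span_blockMonomial hm hX hdeg y ?_ ?_
    · rw [Polynomial.map_pow, Polynomial.map_X, powProd_eq_X_pow_iff (k := k)]
      intro j hj hjn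
      rw [hmk, Ideal.Quotient.mkₐ_eq_mk, Ideal.Quotient.eq_zero_iff_mem, hI]
      exact Ideal.subset_span ⟨j, hj, hjn, rfl⟩
    · rw [Algebra.adjoin_range_eq_range_aeval, hmk, AlgHom.range_eq_top]
      exact Ideal.Quotient.mkₐ_surjective k I
end

section
/- For each 1 ≤ r ≤ n, the congruence x_{n+1−r}^{mr} ≡ −Σ x_1^{m j_1} x_2^{m j_2} ⋯ x_{n+1−r}^{m j_{n+1−r}} holds modulo the ideal I of k[x_1, …, x_n] generated by e_1, …, e_n, where the sum runs over all tuples (j_1, …, j_{n+1−r}) of nonnegative integers with j_1 + ⋯ + j_{n+1−r} = r and j_{n+1−r} ≠ r. Equivalently, the complete homogeneous symmetric polynomial of degree r in the variables x_1^m, …, x_{n+1−r}^m lies in I. -/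
open MvPolynomial Finset

theorem PowerSeries.coeff_prod_one_add_C_mul_X {R ι : Type*} [CommRing R]
    (z : ι → R) (B : Finset ι) (j : ℕ) :
    PowerSeries.coeff j (∏ s ∈ B, (1 + PowerSeries.C (z s) * PowerSeries.X)) =
      ∑ S ∈ B.powersetCard j, ∏ s ∈ S, z s := by
  classical
  rw [Finset.prod_one_add, map_sum, Finset.powersetCard_eq_filter, Finset.sum_filter]
  refine Finset.sum_congr rfl fun S _ => ?_
  rw [Finset.prod_mul_distrib, Finset.prod_const, ← map_prod, PowerSeries.coeff_C_mul,
    PowerSeries.coeff_X_pow]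
  simp [eq_comm]

theorem PowerSeries.one_add_C_neg_mul_X_mul_mk_pow {R : Type*} [CommRing R] (y : R) :
    (1 + PowerSeries.C (-y) * PowerSeries.X) * PowerSeries.mk (fun i => y ^ i) = 1 := by
  ext i
  cases i with
  | zero => simp [add_mul, mul_assoc]
  | succ i =>
    rw [add_mul, one_mul, map_add, mul_assoc, PowerSeries.coeff_C_mul,
      PowerSeries.coeff_succ_X_mul]
    simp [PowerSeries.coeff_one, pow_succ']

/-- If all elementary symmetric functions of positive degree of a finite family vanish, then so do
the complete homogeneous symmetric functions of a subfamily `A` in degrees exceeding the size of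
the complement of `A`. -/
theorem sum_finsuppAntidiag_prod_pow_eq_zero {R ι : Type*} [CommRing R] [Fintype ι]
    [DecidableEq ι] (y : ι → R)
    (hy : ∀ j, 1 ≤ j → j ≤ Fintype.card ι →
      ∑ S ∈ powersetCard j (univ : Finset ι), ∏ s ∈ S, y s = 0)
    (A : Finset ι) (r : ℕ) (hr : #Aᶜ < r) :
    ∑ l ∈ A.finsuppAntidiag r, ∏ s ∈ A, y s ^ l s = 0 := by
  have hE : ∏ s, (1 + PowerSeries.C (-y s) * PowerSeries.X) = 1 := by
    ext j
    rw [PowerSeries.coeff_prod_one_add_C_mul_X, PowerSeries.coeff_one]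
    rcases Nat.eq_zero_or_pos j with rfl | hj
    · simp
    · rw [if_neg hj.ne']
      have h : ∑ S ∈ powersetCard j (univ : Finset ι), ∏ s ∈ S, -y s =
          (-1) ^ j * ∑ S ∈ powersetCard j (univ : Finset ι), ∏ s ∈ S, y s := by
        rw [Finset.mul_sum]
        refine Finset.sum_congr rfl fun S hS => ?_
        rw [Finset.prod_neg, (mem_powersetCard.mp hS).2]
      rw [h]
      by_cases hjn : j ≤ Fintype.card ι
      · rw [hy j hj hjn, mul_zero]
      · rw [powersetCard_eq_empty.mpr (by simpa using hjn)]
        simp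
  have hH : ∏ s ∈ A, PowerSeries.mk (fun i => y s ^ i) =
      ∏ s ∈ Aᶜ, (1 + PowerSeries.C (-y s) * PowerSeries.X) := by
    have hA : (∏ s ∈ A, (1 + PowerSeries.C (-y s) * PowerSeries.X)) *
        ∏ s ∈ A, PowerSeries.mk (fun i => y s ^ i) = 1 := by
      rw [← Finset.prod_mul_distrib]
      exact Finset.prod_eq_one fun s _ => PowerSeries.one_add_C_neg_mul_X_mul_mk_pow (y s)
    rw [← Finset.prod_mul_prod_compl A] at hE
    exact (left_inv_eq_right_inv (by rwa [mul_comm] at hE) hA).symm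
  have h := congrArg (PowerSeries.coeff r) hH
  rw [PowerSeries.coeff_prod_one_add_C_mul_X, powersetCard_eq_empty.mpr hr,
    PowerSeries.coeff_prod] at h
  simpa using h

theorem sum_fin_eq_sum_finsuppAntidiag {M ι : Type*} [AddCommMonoid M] [Fintype ι]
    [DecidableEq ι] (A : Finset ι) (r : ℕ) (p : (ι → Fin (r + 1)) → Prop) [DecidablePred p]
    (hp : ∀ d, p d ↔ (∑ s, (d s : ℕ)) = r ∧ ∀ s, s ∉ A → d s = 0) (f : (ι → ℕ) → M) :
    ∑ d : ι → Fin (r + 1), (if p d then f (fun s => d s) else 0) =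
      ∑ l ∈ A.finsuppAntidiag r, f l := by
  rw [← Finset.sum_filter]
  refine Finset.sum_bij' (fun d _ => Finsupp.equivFunOnFinite.symm fun s => (d s : ℕ))
    (fun l _ s => Fin.ofNat (r + 1) (l s)) ?_ ?_ ?_ ?_ ?_
  · intro d hd
    obtain ⟨h1, h2⟩ := (hp d).mp (mem_filter.mp hd).2
    rw [mem_finsuppAntidiag]
    refine ⟨?_, fun s hs => ?_⟩
    · refine Eq.trans (Finset.sum_subset (subset_univ A) fun s _ hs => ?_) h1
      simp [h2 s hs]
    · by_contra hsA
      simp [h2 s hsA] at hs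
  · intro l hl
    rw [mem_finsuppAntidiag] at hl
    have h0 : ∀ s, s ∉ A → l s = 0 := fun s hs =>
      Finsupp.notMem_support_iff.mp fun h => hs (hl.2 h)
    have hsum : ∑ s, l s = r := by
      rw [← hl.1]
      exact (Finset.sum_subset (subset_univ A) fun s _ hs => h0 s hs).symm
    have hle : ∀ s, l s < r + 1 := fun s => Nat.lt_succ_of_le
      (hsum ▸ Finset.single_le_sum (fun _ _ => Nat.zero_le _) (mem_univ s))
    rw [mem_filter, hp]
    refine ⟨mem_univ _, ?_, fun s hs => by simp [h0 s hs]⟩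
    simpa [Fin.val_ofNat, Nat.mod_eq_of_lt (hle _)] using hsum
  · intro d _
    ext s
    simp
  · intro l hl
    rw [mem_finsuppAntidiag] at hl
    ext s
    have hle : l s < r + 1 := by
      by_cases hs : s ∈ A
      · exact Nat.lt_succ_of_le
          (hl.1 ▸ Finset.single_le_sum (fun _ _ => Nat.zero_le _) hs)
      · rw [Finsupp.notMem_support_iff.mp fun h => hs (hl.2 h)]
        exact Nat.succ_pos r
    simp [Nat.mod_eq_of_lt hle]
  · intro d _
    rfl

/-- Splitting off the term `d = r • single a` from a sum over exponent vectors of total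
degree `r`. -/
theorem pow_add_sum_ne_eq_sum {R ι : Type*} [CommRing R] [Fintype ι] [DecidableEq ι]
    (x : ι → R) (m r : ℕ) (a : ι) (q : (ι → Fin (r + 1)) → Prop) [DecidablePred q]
    (hq : q (Pi.single a (Fin.last r))) :
    x a ^ (m * r) + ∑ d : ι → Fin (r + 1),
        (if (∑ s, (d s : ℕ)) = r ∧ q d ∧ (d a : ℕ) ≠ r then ∏ s, x s ^ (m * (d s : ℕ)) else 0) =
      ∑ d : ι → Fin (r + 1),
        (if (∑ s, (d s : ℕ)) = r ∧ q d then ∏ s, x s ^ (m * (d s : ℕ)) else 0) := by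
  set d₀ : ι → Fin (r + 1) := Pi.single a (Fin.last r) with hd₀
  have hval : ∀ s, (d₀ s : ℕ) = if s = a then r else 0 := fun s => by
    rw [hd₀, Pi.single_apply]
    split_ifs <;> simp
  have hsum : ∑ s, (d₀ s : ℕ) = r := by simp [hval]
  have hprod : ∏ s, x s ^ (m * (d₀ s : ℕ)) = x a ^ (m * r) := by
    simp [hval, mul_ite, pow_ite]
  have huniq : ∀ d : ι → Fin (r + 1), (∑ s, (d s : ℕ)) = r → (d a : ℕ) = r → d = d₀ := by
    intro d h1 h2
    ext s
    rw [hval]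
    split_ifs with hs
    · rw [hs, h2]
    · rw [← Finset.add_sum_erase _ _ (mem_univ a), h2] at h1
      exact Finset.sum_eq_zero_iff.mp (Nat.add_eq_left.mp h1) s (mem_erase.mpr ⟨hs, mem_univ s⟩)
  rw [← Finset.add_sum_erase univ _ (mem_univ d₀), ← Finset.add_sum_erase univ _ (mem_univ d₀),
    if_neg (by simp [hval]), if_pos ⟨hsum, hq⟩, hprod, zero_add]
  congr 1
  refine Finset.sum_congr rfl fun d hd => if_congr ?_ rfl rfl
  exact ⟨fun h => ⟨h.1, h.2.1⟩,
    fun h => ⟨h.1, h.2, fun ha => (mem_erase.mp hd).1 (huniq d h.1 ha)⟩⟩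

/-- for each `1 ≤ r ≤ n`, modulo the ideal `I` generated by
`e_1, …, e_n` (elementary symmetric polynomials in `x_1^m, …, x_n^m`) one has
`x_{n+1-r}^{mr} ≡ − Σ x_1^{m j_1} ⋯ x_{n+1-r}^{m j_{n+1-r}}`, the sum running over
tuples of nonnegative integers `(j_1, …, j_{n+1-r})` with `j_1 + ⋯ + j_{n+1-r} = r`
and `j_{n+1-r} ≠ r` (exponent tuples are encoded as functions `d : Fin n → Fin (r+1)`
vanishing on the variables `x_{n+2-r}, …, x_n`).  Equivalently, the complete
homogeneous symmetric polynomial of degree `r` in `x_1^m, …, x_{n+1-r}^m` lies in `I`. -/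
theorem statement6 {k : Type*} [Field k] (n m : ℕ) (hn : 1 ≤ n) (hm : 1 ≤ m)
    (I : Ideal (MvPolynomial (Fin n) k))
    (hI : I = Ideal.span {f | ∃ j, 1 ≤ j ∧ j ≤ n ∧ f = esymmPow k n m j}) :
    ∀ r : ℕ, (hr1 : 1 ≤ r) → (hrn : r ≤ n) →
      (X (⟨n - r, by omega⟩ : Fin n) ^ (m * r) +
        ∑ d : Fin n → Fin (r + 1),
          (if (∑ s : Fin n, (d s : ℕ)) = r ∧ (∀ s : Fin n, n - r < (s : ℕ) → d s = 0) ∧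
              (d ⟨n - r, by omega⟩ : ℕ) ≠ r
            then ∏ s : Fin n, X s ^ (m * (d s : ℕ)) else 0) ∈ I) ∧
      (∑ d : Fin n → Fin (r + 1),
          (if (∑ s : Fin n, (d s : ℕ)) = r ∧ (∀ s : Fin n, n - r < (s : ℕ) → d s = 0)
            then ∏ s : Fin n, X s ^ (m * (d s : ℕ)) else 0) ∈ I) := by
  intro r hr1 hrn
  have hmem : ∑ d : Fin n → Fin (r + 1),
      (if (∑ s : Fin n, (d s : ℕ)) = r ∧ (∀ s : Fin n, n - r < (s : ℕ) → d s = 0)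
        then ∏ s : Fin n, (X s : MvPolynomial (Fin n) k) ^ (m * (d s : ℕ)) else 0) ∈ I := by
    set A : Finset (Fin n) := Finset.Iic ⟨n - r, by omega⟩ with hA
    have hmemA : ∀ s : Fin n, s ∉ A ↔ n - r < (s : ℕ) := fun s => by
      simp [hA, Fin.lt_def]
    have hcard : #Aᶜ < r := by
      rw [card_compl, hA, Fin.card_Iic, Fintype.card_fin]
      dsimp only
      omega
    rw [sum_fin_eq_sum_finsuppAntidiag A r _ (fun d => by simp only [hmemA])
      (fun l => ∏ s : Fin n, (X s : MvPolynomial (Fin n) k) ^ (m * l s)),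
      ← Ideal.Quotient.eq_zero_iff_mem, map_sum]
    rw [← sum_finsuppAntidiag_prod_pow_eq_zero
      (fun s : Fin n => Ideal.Quotient.mk I (X s ^ m)) ?_ A r hcard]
    · refine Finset.sum_congr rfl fun l hl => ?_
      rw [map_prod]
      simp only [pow_mul, map_pow]
      refine (Finset.prod_subset (subset_univ A) fun s _ hs => ?_).symm
      rw [Finsupp.notMem_support_iff.mp fun h => hs ((mem_finsuppAntidiag.mp hl).2 h), pow_zero]
    · intro j hj hjn
      rw [Fintype.card_fin] at hjn
      have he : Ideal.Quotient.mk I (esymmPow k n m j) = 0 :=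
        Ideal.Quotient.eq_zero_iff_mem.mpr (hI ▸ Ideal.subset_span ⟨j, hj, hjn, rfl⟩)
      simpa only [esymmPow, map_sum, map_prod] using he
  refine ⟨?_, hmem⟩
  rw [pow_add_sum_ne_eq_sum (fun s : Fin n => (X s : MvPolynomial (Fin n) k)) m r
    ⟨n - r, by omega⟩ (fun d => ∀ s : Fin n, n - r < (s : ℕ) → d s = 0)]
  · exact hmem
  · intro s hs
    exact Pi.single_eq_of_ne (by rintro rfl; simp at hs) _
end

section
/- Suppose n ≥ 2, a ≥ 2 and a divides m. Then for every permutation σ of {1, …, n}, the monomial α_σ = x_{σ(1)}^{m−1} x_{σ(2)}^{2m−1} ⋯ x_{σ(n−1)}^{m(n−1)−1} x_{σ(n)}^{mn/a−1} lies in the ideal I_a of k[x_1, …, x_n] generated by e_1, …, e_{n−1} and (x_1 ⋯ x_n)^{m/a}. -/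
open MvPolynomial Finset

/-- suppose `n ≥ 2`, `a ≥ 2` and `a ∣ m`.  For every permutation `σ`
of the variables, the monomial
`α_σ = x_{σ(1)}^{m-1} x_{σ(2)}^{2m-1} ⋯ x_{σ(n-1)}^{m(n-1)-1} x_{σ(n)}^{mn/a-1}`
lies in the ideal `I_a` generated by `e_1, …, e_{n-1}` (elementary symmetric
polynomials in `x_1^m, …, x_n^m`) together with `(x_1 ⋯ x_n)^{m/a}`. -/
theorem statement7 {k : Type*} [Field k] (n m a : ℕ)
    (hn : 2 ≤ n) (hm : 1 ≤ m) (ha : 2 ≤ a) (hdvd : a ∣ m)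
    (Ia : Ideal (MvPolynomial (Fin n) k))
    (hIa : Ia = Ideal.span
      ({f | ∃ j, 1 ≤ j ∧ j ≤ n - 1 ∧ f = esymmPow k n m j} ∪
        {(∏ s : Fin n, X s) ^ (m / a)})) :
    ∀ σ : Equiv.Perm (Fin n),
      (∏ s : Fin n, X (σ s) ^
        (if (s : ℕ) < n - 1 then m * ((s : ℕ) + 1) - 1 else m * n / a - 1)) ∈ Ia := by
  intro σ
  obtain ⟨p, rfl⟩ := hdvd
  have ha0 : 0 < a := by omega
  have hp : 1 ≤ p := Nat.pos_of_mul_pos_left hm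
  have h2p : 2 * p ≤ a * p := Nat.mul_le_mul_right p ha
  have hdiv : a * p * n / a = p * n := by
    rw [mul_assoc, Nat.mul_div_cancel_left _ ha0]
  rw [hIa]
  refine Ideal.mem_of_dvd _ ?_ (Ideal.subset_span (Or.inr rfl))
  rw [Nat.mul_div_cancel_left _ ha0, hdiv, ← Equiv.prod_comp σ, ← Finset.prod_pow]
  refine Finset.prod_dvd_prod_of_dvd _ _ fun s _ => pow_dvd_pow _ ?_
  split_ifs
  · have : a * p * 1 ≤ a * p * ((s : ℕ) + 1) := Nat.mul_le_mul_left _ (by omega)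
    omega
  · have : p * 2 ≤ p * n := Nat.mul_le_mul_left p hn
    omega
end

section
/- Suppose n ≥ 2, a ≥ 2 and a divides m. Then no monomial of k[x_1, …, x_n] generates a block basis for P/I_a: for every monomial f, the set of all monomial factors of f fails to project to a k-vector-space basis of k[x_1, …, x_n]/I_a. In particular the coinvariant algebra of G(m,a,n) with a ≠ 1 admits no block basis. -/
open MvPolynomial Finset

/-- The `j`-th elementary symmetric polynomial in the `m`-th powers lies in the `N`-th power of the
ideal of the variables as soon as `j ≥ 1` and `m ≥ N`. -/
lemma esymmPow_mem_idealOfVars_pow (k : Type*) [CommRing k] (n : ℕ) {m j N : ℕ}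
    (hj : 1 ≤ j) (hN : N ≤ m) : esymmPow k n m j ∈ idealOfVars (Fin n) k ^ N := by
  refine Ideal.sum_mem _ fun S hS => ?_
  obtain ⟨s, hs⟩ : S.Nonempty := by
    rw [← Finset.card_pos, (Finset.mem_powersetCard.1 hS).2]
    exact hj
  refine Ideal.mem_of_dvd _
    (Finset.dvd_prod_of_mem (fun s => (X s : MvPolynomial (Fin n) k) ^ m) hs) ?_
  exact Ideal.pow_le_pow_right hN (Ideal.pow_mem_pow (Ideal.subset_span (Set.mem_range_self s)) m)

/-- The `q`-th power of the product of all `n ≥ 2` variables has order at least `q + 1`. -/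
lemma prod_X_pow_mem_idealOfVars_pow (k : Type*) [CommRing k] {n q : ℕ}
    (hn : 2 ≤ n) (hq : 1 ≤ q) :
    (∏ s : Fin n, (X s : MvPolynomial (Fin n) k)) ^ q ∈ idealOfVars (Fin n) k ^ (q + 1) := by
  have h : (∏ s : Fin n, (X s : MvPolynomial (Fin n) k)) ∈ idealOfVars (Fin n) k ^ n := by
    simpa using Ideal.prod_mem_prod (s := Finset.univ) (I := fun _ : Fin n => idealOfVars (Fin n) k)
      fun s _ => Ideal.subset_span (Set.mem_range_self s)
  refine Ideal.pow_le_pow_right (show q + 1 ≤ n * q by nlinarith) ?_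
  rw [pow_mul]
  exact Ideal.pow_mem_pow h q

/-- If the monomials in the box below `d` span the quotient by an ideal contained in the `N`-th power
of the ideal of the variables, then every side of the box has length at least `N`. -/
lemma le_add_one_of_span_eq_top {k : Type*} [Field k] {n N : ℕ} {I : Ideal (MvPolynomial (Fin n) k)}
    (hI : I ≤ idealOfVars (Fin n) k ^ N) {d : Fin n → ℕ}
    (hspan : Submodule.span k
      (Set.range (fun b : {b : Fin n → ℕ // ∀ s : Fin n, b s ≤ d s} =>
        Ideal.Quotient.mk I (∏ s : Fin n, X s ^ b.1 s))) = ⊤) (s : Fin n) :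
    N ≤ d s + 1 := by
  by_contra! hlt
  set u : Fin n →₀ ℕ := Finsupp.single s (d s + 1) with hu
  have hmap : (Submodule.span k
      (Set.range (fun b : {b : Fin n → ℕ // ∀ s : Fin n, b s ≤ d s} =>
        (∏ s : Fin n, X s ^ b.1 s : MvPolynomial (Fin n) k)))).map
        (Ideal.Quotient.mkₐ k I).toLinearMap = ⊤ := by
    rw [Submodule.map_span, ← Set.range_comp]
    exact hspan
  obtain ⟨p, hp, hpX⟩ : Ideal.Quotient.mk I (X s ^ (d s + 1)) ∈ (Submodule.span k
      (Set.range (fun b : {b : Fin n → ℕ // ∀ s : Fin n, b s ≤ d s} =>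
        (∏ s : Fin n, X s ^ b.1 s : MvPolynomial (Fin n) k)))).map
        (Ideal.Quotient.mkₐ k I).toLinearMap := hmap ▸ Submodule.mem_top
  have hp0 : coeff u p = 0 := by
    suffices h : Submodule.span k
        (Set.range (fun b : {b : Fin n → ℕ // ∀ s : Fin n, b s ≤ d s} =>
          (∏ s : Fin n, X s ^ b.1 s : MvPolynomial (Fin n) k))) ≤
          LinearMap.ker (lcoeff k u) from h hp
    rw [Submodule.span_le]
    rintro _ ⟨b, rfl⟩
    have hb : (∏ s : Fin n, X s ^ b.1 s : MvPolynomial (Fin n) k) =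
        monomial (Finsupp.equivFunOnFinite.symm b.1) 1 := by
      rw [monomial_eq, Finsupp.prod_fintype _ _ (by simp)]
      simp
    have hne : Finsupp.equivFunOnFinite.symm b.1 ≠ u := fun h => by
      have h1 : b.1 s = d s + 1 := by simpa [hu] using DFunLike.congr_fun h s
      have h2 := b.2 s
      omega
    simp [hb, hne]
  have hmem : p - X s ^ (d s + 1) ∈ idealOfVars (Fin n) k ^ N := hI (Ideal.Quotient.eq.1 hpX)
  have hcoeff := (mem_pow_idealOfVars_iff' _ _).1 hmem u (by simpa [hu] using hlt)
  rw [coeff_sub, hp0, hu, coeff_X_pow] at hcoeff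
  simp at hcoeff

/-- suppose `n ≥ 2`, `a ≥ 2` and `a ∣ m`.  Then no monomial of
`k[x_1, …, x_n]` generates a block basis for `P/I_a`: for every monomial
(given by its exponent vector `d : Fin n → ℕ`), the family of all its monomial
factors fails to project to a `k`-vector-space basis of `k[x_1, …, x_n]/I_a`,
where `I_a` is the ideal generated by `e_1, …, e_{n-1}` (elementary symmetric
polynomials in `x_1^m, …, x_n^m`) together with `(x_1 ⋯ x_n)^{m/a}`. -/
theorem statement8 {k : Type*} [Field k] (n m a : ℕ)
    (hn : 2 ≤ n) (hm : 1 ≤ m) (ha : 2 ≤ a) (hdvd : a ∣ m)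
    (Ia : Ideal (MvPolynomial (Fin n) k))
    (hIa : Ia = Ideal.span
      ({f | ∃ j, 1 ≤ j ∧ j ≤ n - 1 ∧ f = esymmPow k n m j} ∪
        {(∏ s : Fin n, X s) ^ (m / a)})) :
    ∀ d : Fin n → ℕ,
      ¬ (LinearIndependent k
          (fun b : {b : Fin n → ℕ // ∀ s : Fin n, b s ≤ d s} =>
            Ideal.Quotient.mk Ia (∏ s : Fin n, X s ^ b.1 s)) ∧
        Submodule.span k
          (Set.range (fun b : {b : Fin n → ℕ // ∀ s : Fin n, b s ≤ d s} =>
            Ideal.Quotient.mk Ia (∏ s : Fin n, X s ^ b.1 s))) = ⊤) := by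
  rintro d ⟨hli, hspan⟩
  have hq : 1 ≤ m / a := Nat.div_pos (Nat.le_of_dvd hm hdvd) (by omega)
  have hqm : m / a + 1 ≤ m := Nat.div_lt_self hm ha
  have hle : Ia ≤ idealOfVars (Fin n) k ^ (m / a + 1) := by
    rw [hIa, Ideal.span_le]
    rintro f (⟨j, hj, -, rfl⟩ | rfl)
    · exact esymmPow_mem_idealOfVars_pow k n hj hqm
    · exact prod_X_pow_mem_idealOfVars_pow k hn hq
  have hd : ∀ s, m / a ≤ d s := fun s =>
    Nat.le_of_succ_le_succ (le_add_one_of_span_eq_top hle hspan s)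
  refine hli.ne_zero ⟨fun _ => m / a, hd⟩ (Ideal.Quotient.eq_zero_iff_mem.2 ?_)
  rw [hIa, Finset.prod_pow]
  exact Ideal.subset_span (Or.inr rfl)
end

section
/- The monomial x_1^{mn−1} x_2^{m(n−1)−1} ⋯ x_n^{m−1} generates a block basis for P/I: the set of all its monomial factors projects to a k-vector-space basis of k[x_1, …, x_n]/I, where I is the ideal generated by e_1, …, e_n. -/
open MvPolynomial Finset

/-- Exponent vectors of the monomial factors of `x_1^{mn-1} x_2^{m(n-1)-1} ⋯ x_n^{m-1}`. -/
abbrev BlockExponent (n m : ℕ) : Type :=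
  {b : Fin n → ℕ // ∀ s : Fin n, b s ≤ m * (n - (s : ℕ)) - 1}

section SplittingTower

variable {R : Type*} [CommRing R] {n m : ℕ}

theorem mem_block_cons_iff (hm : 0 < m) {i : ℕ} {c : Fin n → ℕ} :
    (∀ s : Fin (n + 1), (Fin.cons i c : Fin (n + 1) → ℕ) s ≤ m * (n + 1 - (s : ℕ)) - 1) ↔
      i < m * (n + 1) ∧ ∀ s : Fin n, c s ≤ m * (n - (s : ℕ)) - 1 := by
  have : 0 < m * (n + 1) := by positivity
  rw [Fin.forall_fin_succ]
  simp only [Fin.cons_zero, Fin.cons_succ, Fin.val_zero, Fin.val_succ, Nat.sub_zero,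
    Nat.add_sub_add_right]
  exact and_congr_left fun _ => by omega

theorem exists_monic_factor [Nontrivial R] (hm : 0 < m) {f : Polynomial R} (hf : f.Monic)
    (hdeg : f.natDegree = n + 1) :
    Nontrivial (AdjoinRoot (Polynomial.expand R m f)) ∧
    ∃ g : Polynomial (AdjoinRoot (Polynomial.expand R m f)), g.Monic ∧ g.natDegree = n ∧
      f.map (algebraMap R _) =
        (Polynomial.X - Polynomial.C (AdjoinRoot.root (Polynomial.expand R m f) ^ m)) * g := by
  have hpos : 0 < (Polynomial.expand R m f).natDegree := by
    rw [Polynomial.natDegree_expand, hdeg]; positivity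
  have hnt : Nontrivial (AdjoinRoot (Polynomial.expand R m f)) :=
    nontrivial_of_ne _ _ ((AdjoinRoot.powerBasisAux' (hf.expand hm)).ne_zero ⟨0, hpos⟩)
  refine ⟨hnt, ?_⟩
  have hroot : (f.map (algebraMap R _)).IsRoot
      (AdjoinRoot.root (Polynomial.expand R m f) ^ m) := by
    rw [Polynomial.IsRoot, Polynomial.eval_map_algebraMap, ← Polynomial.expand_aeval,
      AdjoinRoot.aeval_eq, AdjoinRoot.mk_self]
  have hmul := (Polynomial.mul_divByMonic_eq_iff_isRoot.2 hroot)
  have hg := Polynomial.Monic.of_mul_monic_left (Polynomial.monic_X_sub_C _)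
    (hmul ▸ hf.map (algebraMap R _))
  refine ⟨_, hg, ?_, hmul.symm⟩
  have h := congrArg Polynomial.natDegree hmul
  rw [(Polynomial.monic_X_sub_C _).natDegree_mul hg, Polynomial.natDegree_X_sub_C,
    hf.natDegree_map, hdeg] at h
  omega

theorem root_pow_eq_basis {f : Polynomial R} (hf : f.Monic) :
    (fun i : Fin f.natDegree => AdjoinRoot.root f ^ (i : ℕ)) =
      (AdjoinRoot.powerBasis' hf).basis :=
  funext fun i => ((AdjoinRoot.powerBasis' hf).basis_eq_pow i).symm

theorem linearIndependent_root_pow_s9 {f : Polynomial R} (hf : f.Monic) :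
    LinearIndependent R (fun i : Fin f.natDegree => AdjoinRoot.root f ^ (i : ℕ)) := by
  rw [root_pow_eq_basis hf]
  exact (AdjoinRoot.powerBasis' hf).basis.linearIndependent

theorem span_root_pow_s9 {f : Polynomial R} (hf : f.Monic) :
    Submodule.span R (Set.range fun i : Fin f.natDegree => AdjoinRoot.root f ^ (i : ℕ)) = ⊤ := by
  rw [root_pow_eq_basis hf]
  exact (AdjoinRoot.powerBasis' hf).basis.span_eq

theorem adjoin_tail_eq_top {S B : Type*} [CommRing S] [CommRing B] [Algebra R S] [Algebra S B]
    [Algebra R B] [IsScalarTower R S B] {y : Fin (n + 1) → B} {r : S}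
    (hr : algebraMap S B r = y 0) (hy : Algebra.adjoin R (Set.range y) = ⊤) :
    Algebra.adjoin S (Set.range (Fin.tail y)) = ⊤ := by
  have h : Algebra.adjoin R (Set.range y) ≤
      (Algebra.adjoin S (Set.range (Fin.tail y))).restrictScalars R := by
    rw [Algebra.adjoin_le_iff]
    rintro _ ⟨s, rfl⟩
    refine Fin.cases ?_ (fun s => ?_) s
    · have hmem := (Algebra.adjoin S (Set.range (Fin.tail y))).algebraMap_mem r
      rwa [hr] at hmem
    · have hmem : Fin.tail y s ∈ Algebra.adjoin S (Set.range (Fin.tail y)) :=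
        Algebra.subset_adjoin ⟨s, rfl⟩
      exact hmem
  rw [hy] at h
  exact top_le_iff.1 fun _ _ => h Algebra.mem_top

end SplittingTower

theorem exists_linearIndependent_splitting.{u} {m : ℕ} (hm : 0 < m) (n : ℕ) :
    ∀ (R : Type u) [CommRing R] [Nontrivial R] (f : Polynomial R), f.Monic → f.natDegree = n →
    ∃ (A : Type u) (_ : CommRing A) (_ : Algebra R A) (x : Fin n → A),
      f.map (algebraMap R A) = ∏ s, (Polynomial.X - Polynomial.C (x s ^ m)) ∧
      LinearIndependent R (fun b : BlockExponent n m => ∏ s, x s ^ b.1 s) := by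
  induction n with
  | zero =>
    intro R _ _ f hf hdeg
    refine ⟨R, inferInstance, inferInstance, Fin.elim0, ?_, ?_⟩
    · simp [Polynomial.eq_one_of_monic_natDegree_zero hf hdeg]
    · rw [linearIndependent_iff']
      intro s g hg i hi
      have hs : s = {i} := Finset.eq_singleton_iff_unique_mem.2
        ⟨hi, fun j _ => Subsingleton.elim _ _⟩
      simpa [hs] using hg
  | succ n ih =>
    intro R _ _ f hf hdeg
    obtain ⟨_, g, hg, hgdeg, hfg⟩ := exists_monic_factor hm hf hdeg
    obtain ⟨A, _, _, x, hx, hli⟩ := ih (AdjoinRoot (Polynomial.expand R m f)) g hg hgdeg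
    let alg : Algebra R A := Algebra.compHom A (algebraMap R (AdjoinRoot (Polynomial.expand R m f)))
    have tower : IsScalarTower R (AdjoinRoot (Polynomial.expand R m f)) A :=
      IsScalarTower.of_algebraMap_eq fun _ => rfl
    refine ⟨A, inferInstance, alg,
      Fin.cons (algebraMap _ A (AdjoinRoot.root (Polynomial.expand R m f))) x, ?_, ?_⟩
    · rw [IsScalarTower.algebraMap_eq R (AdjoinRoot (Polynomial.expand R m f)) A,
        ← Polynomial.map_map, hfg, Polynomial.map_mul, hx, Fin.prod_univ_succ]
      simp
    · have hprod := linearIndependent_smul (linearIndependent_root_pow_s9 (hf.expand hm)) hli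
      have hd : (Polynomial.expand R m f).natDegree = m * (n + 1) := by
        rw [Polynomial.natDegree_expand, hdeg, mul_comm]
      have hb (b : BlockExponent (n + 1) m) := (mem_block_cons_iff hm).1
        ((Fin.cons_self_tail b.1).symm ▸ b.2)
      let e (b : BlockExponent (n + 1) m) :
          Fin (Polynomial.expand R m f).natDegree × BlockExponent n m :=
        (⟨b.1 0, hd ▸ (hb b).1⟩, ⟨Fin.tail b.1, (hb b).2⟩)
      have he : Function.Injective e := by
        intro b c h
        simp only [e, Prod.mk.injEq, Fin.mk.injEq, Subtype.mk.injEq] at h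
        refine Subtype.ext ?_
        rw [← Fin.cons_self_tail b.1, ← Fin.cons_self_tail c.1, h.1, h.2]
      convert hprod.comp e he using 2 with b
      simp [e, Fin.prod_univ_succ, Algebra.smul_def, Fin.tail]

theorem span_block_eq_top {m : ℕ} (hm : 0 < m) {B : Type*} [CommRing B] (n : ℕ) :
    ∀ (R : Type*) [CommRing R] [Nontrivial R] [Algebra R B] (f : Polynomial R), f.Monic →
    f.natDegree = n → ∀ y : Fin n → B,
      f.map (algebraMap R B) = ∏ s, (Polynomial.X - Polynomial.C (y s ^ m)) →
      Algebra.adjoin R (Set.range y) = ⊤ →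
      Submodule.span R (Set.range fun b : BlockExponent n m => ∏ s, y s ^ b.1 s) = ⊤ := by
  induction n with
  | zero =>
    intro R _ _ _ f _ _ y _ hy
    rw [Set.range_eq_empty, Algebra.adjoin_empty] at hy
    have : Nonempty (BlockExponent 0 m) := ⟨Fin.elim0, fun s => s.elim0⟩
    rw [← Algebra.top_toSubmodule, ← hy, Algebra.toSubmodule_bot, Submodule.one_eq_span]
    simp
  | succ n ih =>
    intro R _ _ _ f hf hdeg y hfy hy
    obtain ⟨_, g, hg, hgdeg, hfg⟩ := exists_monic_factor hm hf hdeg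
    have hroot : Polynomial.eval₂ (algebraMap R B) (y 0) (Polynomial.expand R m f) = 0 := by
      rw [← Polynomial.aeval_def, Polynomial.expand_aeval, ← Polynomial.eval_map_algebraMap, hfy,
        Fin.prod_univ_succ]
      simp
    let alg : Algebra (AdjoinRoot (Polynomial.expand R m f)) B :=
      (AdjoinRoot.lift (algebraMap R B) (y 0) hroot).toAlgebra
    have halg : algebraMap (AdjoinRoot (Polynomial.expand R m f)) B (AdjoinRoot.root _) = y 0 :=
      AdjoinRoot.lift_root hroot
    have tower : IsScalarTower R (AdjoinRoot (Polynomial.expand R m f)) B :=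
      IsScalarTower.of_algebraMap_eq fun r => (AdjoinRoot.lift_of hroot).symm
    have hgy : g.map (algebraMap _ B) =
        ∏ s, (Polynomial.X - Polynomial.C (Fin.tail y s ^ m)) := by
      refine (Polynomial.monic_X_sub_C (y 0 ^ m)).isRegular.left ?_
      simp only
      rw [IsScalarTower.algebraMap_eq R (AdjoinRoot (Polynomial.expand R m f)) B,
        ← Polynomial.map_map, hfg, Polynomial.map_mul, Fin.prod_univ_succ] at hfy
      simpa [halg, Fin.tail] using hfy
    have hadj := adjoin_tail_eq_top halg hy
    have hspan := Submodule.span_smul_of_span_eq_top (span_root_pow_s9 (hf.expand hm))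
      (Set.range fun b : BlockExponent n m => ∏ s, Fin.tail y s ^ b.1 s)
    rw [ih _ g hg hgdeg _ hgy hadj, Submodule.restrictScalars_top] at hspan
    rw [← top_le_iff, ← hspan]
    refine Submodule.span_mono ?_
    rintro _ ⟨_, ⟨i, rfl⟩, _, ⟨c, rfl⟩, rfl⟩
    have hi : (i : ℕ) < m * (n + 1) :=
      i.2.trans_eq (by rw [Polynomial.natDegree_expand, hdeg, mul_comm])
    refine ⟨⟨Fin.cons i c.1, (mem_block_cons_iff hm).2 ⟨hi, c.2⟩⟩, ?_⟩
    simp [Fin.prod_univ_succ, Algebra.smul_def, halg, Fin.tail]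

theorem prod_X_sub_C_eq_X_pow_iff {A : Type*} [CommRing A] {n : ℕ} (y : Fin n → A) :
    ∏ s, (Polynomial.X - Polynomial.C (y s)) = Polynomial.X ^ n ↔
      ∀ j, 1 ≤ j → j ≤ n → ∑ S ∈ Finset.powersetCard j Finset.univ, ∏ s ∈ S, y s = 0 := by
  have hprod : ∏ s, (Polynomial.X - Polynomial.C (y s)) =
      ((Finset.univ.val.map y).map fun t => Polynomial.X - Polynomial.C t).prod := by
    rw [Multiset.map_map]; rfl
  have hcard : (Finset.univ.val.map y).card = n := by simp
  simp only [hprod, ← Finset.esymm_map_val]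
  constructor
  · intro h j hj hjn
    have hc := Multiset.prod_X_sub_C_coeff (Finset.univ.val.map y) (k := n - j) (by omega)
    rw [h, hcard, Polynomial.coeff_X_pow, if_neg (by omega), Nat.sub_sub_self hjn] at hc
    exact ((isUnit_one.neg.pow j).mul_right_eq_zero).1 hc.symm
  · intro h
    rw [Multiset.prod_X_sub_X_eq_sum_esymm, hcard, Finset.sum_eq_single 0]
    · simp [Multiset.esymm]
    · intro j hj hj0
      rw [h j (by omega) (by have := Finset.mem_range.1 hj; omega)]
      simp
    · simp

theorem aeval_esymmPow_s9 {k A : Type*} [CommRing k] [CommRing A] [Algebra k A] {n : ℕ}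
    (x : Fin n → A) (m j : ℕ) :
    aeval x (esymmPow k n m j) =
      ∑ S ∈ Finset.powersetCard j Finset.univ, ∏ s ∈ S, x s ^ m := by
  simp [esymmPow, map_sum, map_prod]

/-- the monomial `x_1^{mn-1} x_2^{m(n-1)-1} ⋯ x_n^{m-1}` generates a
block basis for `P/I`: the family of all its monomial factors (indexed by the
exponent vectors `b ≤ (mn-1, m(n-1)-1, …, m-1)`) projects to a `k`-vector-space
basis of `k[x_1, …, x_n]/I`, where `I` is the ideal generated by the elementary
symmetric polynomials `e_1, …, e_n` in `x_1^m, …, x_n^m`. -/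
theorem statement9 {k : Type*} [Field k] (n m : ℕ) (hn : 1 ≤ n) (hm : 1 ≤ m)
    (I : Ideal (MvPolynomial (Fin n) k))
    (hI : I = Ideal.span {f | ∃ j, 1 ≤ j ∧ j ≤ n ∧ f = esymmPow k n m j}) :
    LinearIndependent k
      (fun b : {b : Fin n → ℕ // ∀ s : Fin n, b s ≤ m * (n - (s : ℕ)) - 1} =>
        Ideal.Quotient.mk I (∏ s : Fin n, X s ^ b.1 s)) ∧
    Submodule.span k
      (Set.range (fun b : {b : Fin n → ℕ // ∀ s : Fin n, b s ≤ m * (n - (s : ℕ)) - 1} =>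
        Ideal.Quotient.mk I (∏ s : Fin n, X s ^ b.1 s))) = ⊤ := by
  subst hI
  set I := Ideal.span {f | ∃ j, 1 ≤ j ∧ j ≤ n ∧ f = esymmPow k n m j} with hI
  have hX : (Polynomial.X ^ n : Polynomial k).Monic := Polynomial.monic_X_pow n
  have hXdeg : (Polynomial.X ^ n : Polynomial k).natDegree = n := Polynomial.natDegree_X_pow n
  constructor
  · obtain ⟨A, _, _, x, hx, hli⟩ := exists_linearIndependent_splitting hm n k _ hX hXdeg
    rw [Polynomial.map_pow, Polynomial.map_X, eq_comm, prod_X_sub_C_eq_X_pow_iff] at hx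
    have hker : ∀ a ∈ I, aeval (R := k) x a = 0 := by
      change I ≤ RingHom.ker (aeval (R := k) x)
      rw [hI, Ideal.span_le]
      rintro _ ⟨j, hj, hjn, rfl⟩
      exact (aeval_esymmPow_s9 x m j).trans (hx j hj hjn)
    refine LinearIndependent.of_comp (Ideal.Quotient.liftₐ I (aeval x) hker).toLinearMap ?_
    have hfun : (Ideal.Quotient.liftₐ I (aeval x) hker).toLinearMap ∘
        (fun b : BlockExponent n m => Ideal.Quotient.mk I (∏ s : Fin n, X s ^ b.1 s)) =
          fun b => ∏ s, x s ^ b.1 s := by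
      funext b
      change aeval x (∏ s : Fin n, X s ^ b.1 s) = _
      simp
    exact hfun ▸ hli
  · have hy : aeval (R := k) (fun s => Ideal.Quotient.mk I (X s)) = Ideal.Quotient.mkₐ k I := by
      ext s; simp
    simp only [map_prod, map_pow]
    refine span_block_eq_top hm n k _ hX hXdeg (fun s => Ideal.Quotient.mk I (X s)) ?_ ?_
    · rw [Polynomial.map_pow, Polynomial.map_X, eq_comm, prod_X_sub_C_eq_X_pow_iff]
      intro j hj hjn
      rw [← aeval_esymmPow_s9 (k := k), hy]
      exact Ideal.Quotient.eq_zero_iff_mem.2 (Ideal.subset_span ⟨j, hj, hjn, rfl⟩)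
    · rw [Algebra.adjoin_range_eq_range_aeval, hy, AlgHom.range_eq_top]
      exact Ideal.Quotient.mkₐ_surjective k I
end

section
/- Let Ψ_n be the set of monomials x_1^{a_1} ⋯ x_n^{a_n} with 0 ≤ a_s < q^{τ(s)} for every 1 ≤ s ≤ n. If w ∈ Ψ_n and 1 ≤ j ≤ n_l, then the polynomial x_{m_{l−1}+j} · w lies in the P^{U_I}-submodule of P generated by Ψ_n. -/
open MvPolynomial Finset

theorem tauf_le {l : ℕ} (m : Fin (l + 1) → ℕ) (s : ℕ) : tauf m s ≤ s :=
  Finset.sup_le fun _ hi => (Finset.mem_filter.1 hi).2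

theorem tauf_le_tauf {l : ℕ} (m : Fin (l + 1) → ℕ) {s t : ℕ} (h : tauf m t ≤ s) :
    tauf m t ≤ tauf m s :=
  Finset.sup_le fun i hi => Finset.le_sup (f := m)
    (Finset.mem_filter.2 ⟨Finset.mem_univ i, (Finset.le_sup (f := m) hi).trans h⟩)

/-- The linear form `Σ_i c_i x_i`. -/
noncomputable def linForm {K : Type*} [Field K] {n : ℕ} (c : Fin n → K) :
    MvPolynomial (Fin n) K :=
  ∑ i, C (c i) * X i

theorem linForm_add {K : Type*} [Field K] {n : ℕ} (c d : Fin n → K) :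
    linForm (c + d) = linForm c + linForm d := by
  simp [linForm, add_mul, Finset.sum_add_distrib]

theorem matAct_X {K : Type*} [Field K] {n : ℕ} (g : Matrix (Fin n) (Fin n) K) (t : Fin n) :
    matAct g (X t) = linForm fun s => g s t := by
  simp [matAct, linForm]

theorem linForm_single {K : Type*} [Field K] {n : ℕ} (t : Fin n) :
    linForm (Pi.single t (1 : K)) = X t := by
  simp [linForm, Pi.single_apply, apply_ite C]

theorem matAct_linForm {K : Type*} [Field K] {n : ℕ} (g : Matrix (Fin n) (Fin n) K)
    (c : Fin n → K) : matAct g (linForm c) = linForm (g.mulVec c) := by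
  have hC (a : K) : matAct g (C a) = C a := (matAct g).commutes a
  simp only [linForm, map_sum, map_mul, matAct_X, hC, Matrix.mulVec, dotProduct,
    Finset.mul_sum, Finset.sum_mul]
  rw [Finset.sum_comm]
  exact Finset.sum_congr rfl fun _ _ => Finset.sum_congr rfl fun _ _ => by ring

/-- The coefficient vectors supported on the first `k` coordinates. -/
noncomputable def leadingVectors (K : Type*) [Field K] [Fintype K] (n k : ℕ) :
    Finset (Fin n → K) :=
  by classical exact Fintype.piFinset fun s : Fin n => if (s : ℕ) < k then Finset.univ else {0}

theorem mem_leadingVectors {K : Type*} [Field K] [Fintype K] {n k : ℕ} {c : Fin n → K} :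
    c ∈ leadingVectors K n k ↔ ∀ s : Fin n, k ≤ (s : ℕ) → c s = 0 := by
  simp only [leadingVectors, Fintype.mem_piFinset]
  refine forall_congr' fun s => ?_
  by_cases h : (s : ℕ) < k
  · simp [h]
  · simp [h, not_lt.1 h]

theorem card_leadingVectors (K : Type*) [Field K] [Fintype K] {n k : ℕ} (hk : k ≤ n) :
    (leadingVectors K n k).card = Fintype.card K ^ k := by
  have hcard : (Finset.univ.filter fun s : Fin n => (s : ℕ) < k).card = k := by
    rw [Fin.card_filter_val_lt, min_eq_right hk]
  simp only [leadingVectors, Fintype.card_piFinset, apply_ite Finset.card, Finset.card_univ,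
    Finset.card_singleton]
  rw [Finset.prod_ite, Finset.prod_const, Finset.prod_const_one, mul_one, hcard]

/-- The monic polynomial `Π_u (T + u)` with `u` running over the linear forms in the first
`k` variables. -/
noncomputable def orbitPoly (K : Type*) [Field K] [Fintype K] (n k : ℕ) :
    Polynomial (MvPolynomial (Fin n) K) :=
  ∏ c ∈ leadingVectors K n k, (Polynomial.X + Polynomial.C (linForm c))

theorem orbitPoly_monic (K : Type*) [Field K] [Fintype K] (n k : ℕ) :
    (orbitPoly K n k).Monic :=
  Polynomial.monic_prod_of_monic _ _ fun _ _ => Polynomial.monic_X_add_C _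

theorem natDegree_orbitPoly (K : Type*) [Field K] [Fintype K] {n k : ℕ} (hk : k ≤ n) :
    (orbitPoly K n k).natDegree = Fintype.card K ^ k := by
  rw [orbitPoly, Polynomial.natDegree_prod_of_monic _ _ fun _ _ => Polynomial.monic_X_add_C _]
  simp [card_leadingVectors K hk]

theorem prod_leadingVectors_mulVec {K : Type*} [Field K] [Fintype K] {n l : ℕ}
    {m : Fin (l + 1) → ℕ} {g : GL (Fin n) K} (hg : g ∈ USet K n m) (k : ℕ)
    {M : Type*} [CommMonoid M] (f : (Fin n → K) → M) :
    ∏ c ∈ leadingVectors K n k, f ((g : Matrix (Fin n) (Fin n) K).mulVec c) =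
      ∏ c ∈ leadingVectors K n k, f c := by
  classical
  have hinj : Function.Injective (g : Matrix (Fin n) (Fin n) K).mulVec :=
    Matrix.mulVec_injective_of_isUnit g.isUnit
  have himage : (leadingVectors K n k).image (g : Matrix (Fin n) (Fin n) K).mulVec =
      leadingVectors K n k := by
    refine Finset.eq_of_subset_of_card_le (Finset.image_subset_iff.2 fun c hc => ?_)
      (Finset.card_image_of_injective _ hinj).ge
    rw [mem_leadingVectors] at hc ⊢
    intro s hs
    rw [Matrix.mulVec, dotProduct]
    refine Finset.sum_eq_zero fun t _ => ?_
    rcases le_or_gt k (t : ℕ) with ht | ht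
    · rw [hc t ht, mul_zero]
    · rw [hg s t (tauf_le_tauf m ((tauf_le m t).trans (by omega))),
        if_neg (by rintro rfl; omega), zero_mul]
  conv_rhs => rw [← himage, Finset.prod_image hinj.injOn]

theorem map_orbitPoly {K : Type*} [Field K] [Fintype K] {n l : ℕ}
    {m : Fin (l + 1) → ℕ} {g : GL (Fin n) K} (hg : g ∈ USet K n m) (k : ℕ) :
    (orbitPoly K n k).map (matAct (g : Matrix (Fin n) (Fin n) K)).toRingHom =
      orbitPoly K n k := by
  simp only [orbitPoly, Polynomial.map_prod, Polynomial.map_add, Polynomial.map_X,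
    Polynomial.map_C, AlgHom.toRingHom_eq_coe, RingHom.coe_coe, matAct_linForm]
  exact prod_leadingVectors_mulVec hg k fun c => Polynomial.X + Polynomial.C (linForm c)

theorem coeff_orbitPoly_mem_invariants (K : Type*) [Field K] [Fintype K] {l : ℕ} (n : ℕ)
    (m : Fin (l + 1) → ℕ) (k d : ℕ) :
    (orbitPoly K n k).coeff d ∈ invariants (USet K n m) := by
  intro g hg
  conv_rhs => rw [← map_orbitPoly hg k, Polynomial.coeff_map]
  rfl

theorem eval_orbitPoly_mem_invariants (K : Type*) [Field K] [Fintype K] {l : ℕ} (n : ℕ)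
    (m : Fin (l + 1) → ℕ) (t : Fin n) :
    (orbitPoly K n (tauf m t)).eval (X t) ∈ invariants (USet K n m) := by
  intro g hg
  set d : Fin n → K := (fun s => (g : Matrix (Fin n) (Fin n) K) s t) - Pi.single t 1 with hd
  have hmem : d ∈ leadingVectors K n (tauf m t) := mem_leadingVectors.2 fun s hs => by
    rw [hd]
    simp only [Pi.sub_apply, hg s t (tauf_le_tauf m hs), Pi.single_apply, sub_self]
  have hX : matAct (g : Matrix (Fin n) (Fin n) K) (X t) = X t + linForm d := by
    rw [matAct_X, ← linForm_single t, ← linForm_add]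
    congr 1
    ext s
    simp [hd]
  simp only [orbitPoly, Polynomial.eval_prod, Polynomial.eval_add, Polynomial.eval_X,
    Polynomial.eval_C, map_prod, map_add, matAct_linForm, hX]
  rw [prod_leadingVectors_mulVec hg _ fun c => X t + linForm d + linForm c]
  refine Finset.prod_nbij' (d + ·) (· - d) ?_ ?_ ?_ ?_ ?_
  · intro c hc
    rw [mem_leadingVectors] at *
    intro s hs
    simp [hc s hs, hmem s hs]
  · intro c hc
    rw [mem_leadingVectors] at *
    intro s hs
    simp [hc s hs, hmem s hs]
  · intro c _
    simp
  · intro c _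
    simp
  · intro c _
    rw [linForm_add, add_assoc]

/-- let `Ψ_n` be the set of monomials `x_1^{a_1} ⋯ x_n^{a_n}` with
`0 ≤ a_s < q^{τ(s)}`.  If `w ∈ Ψ_n` and `1 ≤ j ≤ n_l`, then `x_{m_{l-1}+j} · w`
lies in the `P^{U_I}`-submodule of `P` generated by `Ψ_n`. -/
theorem statement10 {K : Type*} [Field K] [Fintype K] {p r : ℕ} (hp : p.Prime)
    (hr : 0 < r) (hcard : Fintype.card K = p ^ r)
    (n l : ℕ) (hl : 0 < l) (m : Fin (l + 1) → ℕ)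
    (hm0 : m 0 = 0) (hmono : StrictMono m) (hlast : m (Fin.last l) = n)
    (w : MvPolynomial (Fin n) K) (a : Fin n → ℕ)
    (ha : ∀ s : Fin n, a s < Fintype.card K ^ tauf m (s : ℕ))
    (hw : w = ∏ s : Fin n, X s ^ a s)
    (i : Fin l) (hi : (i : ℕ) = l - 1) (j : Fin (m i.succ - m i.castSucc)) :
    X (emb n m hmono hlast i j) * w ∈
      Submodule.span (invariants (USet K n m))
        {f : MvPolynomial (Fin n) K | ∃ b : Fin n → ℕ,
          (∀ s : Fin n, b s < Fintype.card K ^ tauf m (s : ℕ)) ∧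
          f = ∏ s : Fin n, X s ^ b s} := by
  classical
  subst hw
  set t := emb n m hmono hlast i j
  set N := Fintype.card K ^ tauf m (t : ℕ) with hN
  set S := Submodule.span (invariants (USet K n m))
        {f : MvPolynomial (Fin n) K | ∃ b : Fin n → ℕ,
          (∀ s : Fin n, b s < Fintype.card K ^ tauf m (s : ℕ)) ∧
          f = ∏ s : Fin n, X s ^ b s}
  set R : MvPolynomial (Fin n) K := ∏ s ∈ Finset.univ.erase t, X s ^ a s with hR
  have hmem (e : ℕ) (he : e < N) : X t ^ e * R ∈ S := by
    refine Submodule.subset_span ⟨Function.update a t e, fun s => ?_, ?_⟩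
    · rcases eq_or_ne s t with rfl | hs
      · simpa using he
      · simpa [hs] using ha s
    · rw [← Finset.mul_prod_erase _ _ (Finset.mem_univ t), Function.update_self]
      congr 1
      exact Finset.prod_congr rfl fun s hs => by
        rw [Function.update_of_ne (Finset.ne_of_mem_erase hs)]
  have hsmul {c f : MvPolynomial (Fin n) K} (hc : c ∈ invariants (USet K n m))
      (hf : f ∈ S) : c * f ∈ S :=
    S.smul_mem (⟨c, hc⟩ : invariants (USet K n m)) hf
  rw [← Finset.mul_prod_erase _ _ (Finset.mem_univ t), ← mul_assoc, ← pow_succ', ← hR]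
  rcases (Nat.succ_le_of_lt (ha t)).lt_or_eq with h | h
  · exact hmem _ h
  have hdeg : (orbitPoly K n (tauf m t)).natDegree = N :=
    natDegree_orbitPoly K ((tauf_le m t).trans t.2.le)
  have heval := Polynomial.eval_eq_sum_range (p := orbitPoly K n (tauf m t)) (X t)
  rw [Finset.sum_range_succ, (orbitPoly_monic K n _).coeff_natDegree, one_mul, hdeg] at heval
  have hpow : X t ^ (a t + 1) * R =
      (orbitPoly K n (tauf m t)).eval (X t) * (X t ^ 0 * R) -
        ∑ e ∈ Finset.range N, (orbitPoly K n (tauf m t)).coeff e * (X t ^ e * R) := by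
    rw [show a t + 1 = N from h, heval]
    simp only [← mul_assoc, ← Finset.sum_mul]
    ring
  rw [hpow]
  exact S.sub_mem
    (hsmul (eval_orbitPoly_mem_invariants K n m t) (hmem 0 ((Nat.zero_le _).trans_lt (ha t))))
    (S.sum_mem fun e he => hsmul (coeff_orbitPoly_mem_invariants K n m _ e)
      (hmem e (Finset.mem_range.1 he)))
end
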